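/- Let 1 ≤ p₀, p₁, p₂, q₁, q₂, q₃ ≤ ∞ satisfy 1/p₁ + 1/p₂ > 1/p₀ and 1/q₁ + 1/q₂ ≥ 1 + 1/q₃. Then there is a constant C > 0 such that for all Schwartz functions f, g on ℝ, the bilinear Hilbert transform satisfies ‖BH(f,g)‖_{M^{p₀,q₃}} ≤ C · ‖f‖_{M^{p₁,q₁}} · ‖g‖_{M^{p₂,q₂}}. -/

import Mathlib

open MeasureTheory Complex
open scoped ENNReal NNReal

noncomputable section

/-- `e2pi a = e^{2πi a}`. -/
def e2pi (a : ℝ) : ℂ := Complex.exp (2 * Real.pi * Complex.I * (a : ℂ))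

/-- Short-time Fourier transform on `ℝ`: `V_φ f (t, ν)`. -/
def STFT1 (φ f : ℝ → ℂ) (t ν : ℝ) : ℂ := ∫ y : ℝ, f y * e2pi (-(y * ν)) * φ (y - t)

/-- The Gaussian window `e^{-x²}` on `ℝ`. -/
def gauss1 : ℝ → ℂ := fun x => (Real.exp (-x ^ 2) : ℝ)

/-- `L^p`-type norm (`ℝ≥0∞`-valued) with essential supremum in case `p = ∞`. -/
def eNorm {α : Type*} [MeasurableSpace α] (μ : Measure α) (p : ℝ≥0∞) (F : α → ℝ≥0∞) : ℝ≥0∞ :=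
  if p = ∞ then essSup F μ else (∫⁻ a, F a ^ p.toReal ∂μ) ^ (1 / p.toReal)

/-- Modulation space norm `‖f‖_{M^{p,q}}` on `ℝ` with the Gaussian window. -/
def modNorm1 (p q : ℝ≥0∞) (f : ℝ → ℂ) : ℝ≥0∞ :=
  eNorm volume q fun ν => eNorm volume p fun t => (‖STFT1 gauss1 f t ν‖₊ : ℝ≥0∞)

/-- Fourier transform on `ℝ`. -/
def FT1 (f : ℝ → ℂ) (ξ : ℝ) : ℂ := ∫ y : ℝ, f y * e2pi (-(y * ξ))

/-- Symbol short-time Fourier transform of a symbol on `ℝ³`. -/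
def symbSTFT3 (Ψ σ : ℝ × ℝ × ℝ → ℂ) (x t₁ t₂ ξ₁ ξ₂ ν : ℝ) : ℂ :=
  ∫ X : ℝ × ℝ × ℝ, σ X * Ψ (X.1 - x, X.2.1 - ξ₁, X.2.2 - ξ₂) *
    e2pi (-(X.1 * ν - t₁ * X.2.1 - t₂ * X.2.2))

/-- Symbol short-time Fourier transform of a symbol on `ℝ⁴`. -/
def symbSTFT4 (Ψ σ : ℝ × ℝ × ℝ × ℝ → ℂ) (x t₁ t₂ t₃ ξ₁ ξ₂ ξ₃ ν : ℝ) : ℂ :=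
  ∫ X : ℝ × ℝ × ℝ × ℝ, σ X * Ψ (X.1 - x, X.2.1 - ξ₁, X.2.2.1 - ξ₂, X.2.2.2 - ξ₃) *
    e2pi (-(X.1 * ν - t₁ * X.2.1 - t₂ * X.2.2.1 - t₃ * X.2.2.2))

/-- The bilinear Hilbert transform as an (absolutely convergent) bilinear Fourier
multiplier for Schwartz functions. -/
def BH (f g : ℝ → ℂ) (x : ℝ) : ℂ :=
  ∫ ξ : ℝ × ℝ, (-(Real.pi : ℂ) * Complex.I * (Real.sign (ξ.1 - ξ.2) : ℝ)) *
    FT1 f ξ.1 * FT1 g ξ.2 * e2pi (x * (ξ.1 + ξ.2))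

/-- The trilinear Hilbert transform as an (absolutely convergent) trilinear Fourier
multiplier for Schwartz functions. -/
def TH (f g h : ℝ → ℂ) (x : ℝ) : ℂ :=
  ∫ ξ : ℝ × ℝ × ℝ, ((Real.pi : ℂ) * Complex.I * (Real.sign (ξ.1 - ξ.2.1 - 2 * ξ.2.2) : ℝ)) *
    FT1 f ξ.1 * FT1 g ξ.2.1 * FT1 h ξ.2.2 * e2pi (x * (ξ.1 + ξ.2.1 + ξ.2.2))

/-- The `L^{1/a}` norm of a `ℝ≥0∞`-valued function on `ℝ`, where `a = 0` stands for `L^∞`. -/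
def recipNorm (a : ℝ) (F : ℝ → ℝ≥0∞) : ℝ≥0∞ :=
  if a = 0 then essSup F volume else (∫⁻ x, F x ^ (1 / a)) ^ a

theorem recipNorm_zero (F : ℝ → ℝ≥0∞) : recipNorm 0 F = essSup F volume := if_pos rfl

theorem recipNorm_of_pos {a : ℝ} (ha : 0 < a) (F : ℝ → ℝ≥0∞) :
    recipNorm a F = (∫⁻ x, F x ^ (1 / a)) ^ a := if_neg ha.ne'

theorem eNorm_eq_recipNorm {p : ℝ≥0∞} (hp : 1 ≤ p) (F : ℝ → ℝ≥0∞) :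
    eNorm volume p F = recipNorm (1 / p).toReal F := by
  rcases eq_or_ne p ∞ with rfl | hp'
  · simp [eNorm, recipNorm_zero]
  · have h : 0 < p.toReal := ENNReal.toReal_pos (zero_lt_one.trans_le hp).ne' hp'
    rw [recipNorm_of_pos (by simpa using h)]
    simp [eNorm, hp']

theorem recipNorm_mono {a : ℝ} (ha : 0 ≤ a) {F G : ℝ → ℝ≥0∞} (h : ∀ x, F x ≤ G x) :
    recipNorm a F ≤ recipNorm a G := by
  rcases ha.eq_or_lt with rfl | ha
  · simpa only [recipNorm_zero] using essSup_mono_ae (Filter.Eventually.of_forall h)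
  · rw [recipNorm_of_pos ha, recipNorm_of_pos ha]
    gcongr with x
    exact h x

theorem recipNorm_const_mul {a : ℝ} (ha : 0 ≤ a) (K : ℝ≥0∞) {F : ℝ → ℝ≥0∞}
    (hF : Measurable F) : recipNorm a (fun x => K * F x) = K * recipNorm a F := by
  rcases ha.eq_or_lt with rfl | ha
  · simp only [recipNorm_zero, ENNReal.essSup_const_mul]
  · rw [recipNorm_of_pos ha, recipNorm_of_pos ha]
    simp only [ENNReal.mul_rpow_of_nonneg _ _ (by positivity : 0 ≤ 1 / a)]
    rw [lintegral_const_mul _ (hF.pow_const _),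
      ENNReal.mul_rpow_of_nonneg _ _ ha.le, ← ENNReal.rpow_mul, one_div_mul_cancel ha.ne',
      ENNReal.rpow_one]

theorem recipNorm_comp_measurePreserving {T : ℝ → ℝ} (hT : MeasurePreserving T volume volume)
    (a : ℝ) {F : ℝ → ℝ≥0∞} (hF : Measurable F) :
    recipNorm a (fun x => F (T x)) = recipNorm a F := by
  unfold recipNorm
  split_ifs
  · conv_rhs => rw [← hT.map_eq]
    exact (essSup_map_measure_of_measurable hF hT.measurable.aemeasurable).symm
  · rw [hT.lintegral_comp (f := fun x => F x ^ (1 / a)) (hF.pow_const _)]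

theorem recipNorm_rpow {a α : ℝ} (ha : 0 < a) (hα : 0 < α) (F : ℝ → ℝ≥0∞) :
    recipNorm a (fun x => F x ^ α) = recipNorm (a / α) F ^ α := by
  rw [recipNorm_of_pos ha, recipNorm_of_pos (by positivity), ← ENNReal.rpow_mul,
    div_mul_cancel₀ _ hα.ne']
  congr 2 with x
  rw [← ENNReal.rpow_mul]
  congr 1
  field_simp

theorem lintegral_mul_le_recipNorm {a b : ℝ} (ha : 0 ≤ a) (hb : 0 ≤ b) (hab : a + b = 1)
    {F G : ℝ → ℝ≥0∞} (hF : Measurable F) (hG : Measurable G) :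
    ∫⁻ x, F x * G x ≤ recipNorm a F * recipNorm b G := by
  rcases ha.eq_or_lt with rfl | ha
  · obtain rfl : b = 1 := by linarith
    rw [recipNorm_zero, recipNorm_of_pos one_pos]
    simp only [div_one, ENNReal.rpow_one]
    rw [← lintegral_const_mul _ hG]
    refine lintegral_mono_ae ?_
    filter_upwards [ENNReal.ae_le_essSup F] with x hx
    gcongr
  rcases hb.eq_or_lt with rfl | hb
  · obtain rfl : a = 1 := by linarith
    rw [recipNorm_zero, recipNorm_of_pos one_pos]
    simp only [div_one, ENNReal.rpow_one]
    rw [← lintegral_mul_const _ hF]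
    refine lintegral_mono_ae ?_
    filter_upwards [ENNReal.ae_le_essSup G] with x hx
    gcongr
  rw [recipNorm_of_pos ha, recipNorm_of_pos hb]
  refine le_trans (le_of_eq ?_) (ENNReal.lintegral_mul_norm_pow_le
    (hF.pow_const _).aemeasurable (hG.pow_const _).aemeasurable ha.le hb.le hab)
  simp_rw [← ENNReal.rpow_mul, one_div_mul_cancel ha.ne', one_div_mul_cancel hb.ne',
    ENNReal.rpow_one]

theorem recipNorm_geom_mean_le {c θ : ℝ} (hc : 0 ≤ c) (hθ₀ : 0 ≤ θ) (hθ₁ : θ ≤ 1)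
    {X Y : ℝ → ℝ≥0∞} (hX : Measurable X) (hY : Measurable Y) :
    recipNorm c (fun x => X x ^ θ * Y x ^ (1 - θ)) ≤
      recipNorm c X ^ θ * recipNorm c Y ^ (1 - θ) := by
  have hθ' : 0 ≤ 1 - θ := by linarith
  rcases hc.eq_or_lt with rfl | hc
  · simp only [recipNorm_zero]
    refine essSup_le_of_ae_le _ ?_
    filter_upwards [ENNReal.ae_le_essSup X, ENNReal.ae_le_essSup Y] with x h₁ h₂
    gcongr
  · rw [recipNorm_of_pos hc, recipNorm_of_pos hc, recipNorm_of_pos hc, ← ENNReal.rpow_mul,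
      ← ENNReal.rpow_mul, mul_comm c, mul_comm c, ENNReal.rpow_mul, ENNReal.rpow_mul,
      ← ENNReal.mul_rpow_of_nonneg _ _ hc.le]
    refine ENNReal.rpow_le_rpow ?_ hc.le
    refine le_trans (le_of_eq ?_) (ENNReal.lintegral_mul_norm_pow_le
      (hX.pow_const (1 / c)).aemeasurable (hY.pow_const (1 / c)).aemeasurable hθ₀ hθ' (by ring))
    congr 1 with x
    rw [ENNReal.mul_rpow_of_nonneg _ _ (by positivity), ← ENNReal.rpow_mul, ← ENNReal.rpow_mul,
      ← ENNReal.rpow_mul, ← ENNReal.rpow_mul, mul_comm θ, mul_comm (1 - θ)]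

/-- The function `S` cut off at height `n` and to the interval `[-n, n]`. -/
def cutoff (S : ℝ → ℝ≥0∞) (n : ℕ) : ℝ → ℝ≥0∞ :=
  (Set.Icc (-n : ℝ) n).indicator fun t => min (S t) n

theorem measurable_cutoff {S : ℝ → ℝ≥0∞} (hS : Measurable S) (n : ℕ) :
    Measurable (cutoff S n) :=
  (hS.min measurable_const).indicator measurableSet_Icc

theorem cutoff_le (S : ℝ → ℝ≥0∞) (n : ℕ) (t : ℝ) : cutoff S n t ≤ S t :=
  Set.indicator_le' (fun _ _ => min_le_left _ _) (fun _ _ => zero_le) t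

theorem cutoff_mono (S : ℝ → ℝ≥0∞) (t : ℝ) : Monotone fun n => cutoff S n t := by
  intro m n hmn
  have h : (m : ℝ) ≤ n := by exact_mod_cast hmn
  unfold cutoff
  by_cases ht : t ∈ Set.Icc (-m : ℝ) m
  · have ht' : t ∈ Set.Icc (-n : ℝ) n := ⟨by linarith [ht.1], by linarith [ht.2]⟩
    simp only [Set.indicator_of_mem ht, Set.indicator_of_mem ht']
    gcongr
  · simp only [Set.indicator_of_notMem ht, zero_le]

theorem tendsto_cutoff (S : ℝ → ℝ≥0∞) (t : ℝ) :
    Filter.Tendsto (fun n => cutoff S n t) Filter.atTop (nhds (S t)) := by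
  have h : Filter.Tendsto (fun n : ℕ => min (S t) (n : ℝ≥0∞)) Filter.atTop (nhds (S t)) := by
    simpa using (tendsto_const_nhds (x := S t)).min ENNReal.tendsto_nat_nhds_top
  refine h.congr' ?_
  obtain ⟨N, hN⟩ := exists_nat_ge |t|
  filter_upwards [Filter.eventually_ge_atTop N] with n hn
  have hn' : (N : ℝ) ≤ n := by exact_mod_cast hn
  rw [cutoff, Set.indicator_of_mem]
  exact abs_le.mp (hN.trans hn')

theorem lintegral_cutoff_rpow_ne_top (S : ℝ → ℝ≥0∞) (n : ℕ) {q : ℝ} (hq : 0 < q) :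
    ∫⁻ t, cutoff S n t ^ q ≠ ∞ := by
  have h : ∀ t, cutoff S n t ^ q ≤
      (Set.Icc (-n : ℝ) n).indicator (fun _ => (n : ℝ≥0∞) ^ q) t := by
    intro t
    unfold cutoff
    by_cases ht : t ∈ Set.Icc (-n : ℝ) n
    · simp only [Set.indicator_of_mem ht]
      gcongr
      exact min_le_right _ _
    · simp only [Set.indicator_of_notMem ht, ENNReal.zero_rpow_of_pos hq, le_refl]
  refine ((lintegral_mono h).trans_lt ?_).ne
  rw [lintegral_indicator_const measurableSet_Icc, Real.volume_Icc]
  exact ENNReal.mul_lt_top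
    (ENNReal.rpow_lt_top_of_nonneg hq.le (ENNReal.natCast_ne_top n)) ENNReal.ofReal_lt_top

/-- Minkowski's integral inequality. -/
theorem recipNorm_lintegral_le {α : Type*} [MeasurableSpace α] {μ : Measure α} [SFinite μ]
    {c : ℝ} (hc₀ : 0 ≤ c) (hc₁ : c ≤ 1) {Φ : ℝ → α → ℝ≥0∞} {M : α → ℝ≥0∞}
    (hΦ : Measurable (Function.uncurry Φ)) (hM : Measurable M)
    (h : ∀ ω, recipNorm c (fun t => Φ t ω) ≤ M ω) :
    recipNorm c (fun t => ∫⁻ ω, Φ t ω ∂μ) ≤ ∫⁻ ω, M ω ∂μ := by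
  rcases hc₀.eq_or_lt with rfl | hc
  · simp only [recipNorm_zero] at h ⊢
    have hmeas : MeasurableSet {z : α × ℝ | Φ z.2 z.1 ≤ M z.1} :=
      measurableSet_le (hΦ.comp measurable_swap) (hM.comp measurable_fst)
    have h₁ : ∀ᵐ z ∂(μ.prod volume), Φ z.2 z.1 ≤ M z.1 := by
      rw [Measure.ae_prod_iff_ae_ae hmeas]
      refine Filter.Eventually.of_forall fun ω => ?_
      filter_upwards [ENNReal.ae_le_essSup fun t => Φ t ω] with t ht
      exact ht.trans (h ω)
    have h₂ : ∀ᵐ z ∂(volume.prod μ), Φ z.1 z.2 ≤ M z.2 := by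
      rw [← Measure.prod_swap] at h₁
      exact ae_of_ae_map measurable_swap.aemeasurable h₁
    have hmeas' : MeasurableSet {z : ℝ × α | Φ z.1 z.2 ≤ M z.2} :=
      measurableSet_le hΦ (hM.comp measurable_snd)
    rw [Measure.ae_prod_iff_ae_ae hmeas'] at h₂
    refine essSup_le_of_ae_le _ ?_
    filter_upwards [h₂] with t ht
    exact lintegral_mono_ae ht
  set S : ℝ → ℝ≥0∞ := fun t => ∫⁻ ω, Φ t ω ∂μ with hS
  have hSm : Measurable S := hΦ.lintegral_prod_right'
  have hq : 0 < 1 / c := by positivity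
  have hq₁ : 0 ≤ 1 / c - 1 := by
    rw [sub_nonneg, le_div_iff₀ hc]; linarith
  have key : ∀ n, (∫⁻ t, cutoff S n t ^ (1 / c)) ^ c ≤ ∫⁻ ω, M ω ∂μ := by
    intro n
    set R := cutoff S n with hR
    have hRm : Measurable R := measurable_cutoff hSm n
    set I := ∫⁻ t, R t ^ (1 / c) with hI
    have hItop : I ≠ ∞ := lintegral_cutoff_rpow_ne_top S n hq
    have hdual : recipNorm (1 - c) (fun t => R t ^ (1 / c - 1)) ≤ I ^ (1 - c) := by
      rcases hc₁.eq_or_lt with rfl | hc₁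
      · simp only [sub_self, recipNorm_zero, div_one, ENNReal.rpow_zero]
        exact essSup_le_of_ae_le _ (Filter.Eventually.of_forall fun _ => le_rfl)
      · have hc' : 0 < 1 - c := by linarith
        rw [recipNorm_of_pos hc']
        refine le_of_eq ?_
        congr 2 with t
        rw [← ENNReal.rpow_mul]
        congr 1
        field_simp
    have hle : I ≤ (∫⁻ ω, M ω ∂μ) * I ^ (1 - c) := by
      calc I ≤ ∫⁻ t, S t * R t ^ (1 / c - 1) := by
            refine lintegral_mono fun t => ?_
            calc R t ^ (1 / c) = R t ^ (1 + (1 / c - 1)) := by congr 1; ring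
              _ = R t * R t ^ (1 / c - 1) := by
                rw [ENNReal.rpow_add_of_nonneg _ _ zero_le_one hq₁, ENNReal.rpow_one]
              _ ≤ _ := by gcongr; exact cutoff_le S n t
        _ = ∫⁻ t, ∫⁻ ω, Φ t ω * R t ^ (1 / c - 1) ∂μ := by
            congr 1 with t
            exact (lintegral_mul_const _ (hΦ.comp measurable_prodMk_left)).symm
        _ = ∫⁻ ω, (∫⁻ t, Φ t ω * R t ^ (1 / c - 1)) ∂μ :=
            lintegral_lintegral_swap
              (hΦ.mul ((hRm.comp measurable_fst).pow_const _)).aemeasurable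
        _ ≤ ∫⁻ ω, M ω * I ^ (1 - c) ∂μ := by
            refine lintegral_mono fun ω => ?_
            refine (lintegral_mul_le_recipNorm hc.le (by linarith : (0 : ℝ) ≤ 1 - c) (by ring)
              (hΦ.comp measurable_prodMk_right) (hRm.pow_const _)).trans ?_
            gcongr
            exact h ω
        _ = _ := lintegral_mul_const _ hM
    rcases eq_or_ne I 0 with h0 | h0
    · rw [h0, ENNReal.zero_rpow_of_pos hc]
      exact zero_le
    · have h1 : I ^ c * I ^ (1 - c) ≤ (∫⁻ ω, M ω ∂μ) * I ^ (1 - c) := by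
        rw [← ENNReal.rpow_add _ _ h0 hItop]
        simpa using hle
      exact (ENNReal.mul_le_mul_iff_left (ENNReal.rpow_pos (pos_iff_ne_zero.mpr h0) hItop).ne'
        (ENNReal.rpow_ne_top_of_nonneg (by linarith) hItop)).mp h1
  have hlim : Filter.Tendsto (fun n => ∫⁻ t, cutoff S n t ^ (1 / c)) Filter.atTop
      (nhds (∫⁻ t, S t ^ (1 / c))) := by
    refine lintegral_tendsto_of_tendsto_of_monotone
      (fun n => ((measurable_cutoff hSm n).pow_const _).aemeasurable)
      (Filter.Eventually.of_forall fun t m n hmn => ?_)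
      (Filter.Eventually.of_forall fun t => ?_)
    · exact ENNReal.rpow_le_rpow (cutoff_mono S t hmn) hq.le
    · exact (ENNReal.continuous_rpow_const.tendsto _).comp (tendsto_cutoff S t)
  rw [recipNorm_of_pos hc]
  exact le_of_tendsto ((ENNReal.continuous_rpow_const.tendsto _).comp hlim)
    (Filter.Eventually.of_forall key)

/-- Young's convolution inequality. -/
theorem recipNorm_convolution_le {a b c : ℝ} (hc : 0 ≤ c) (ha : a ≤ 1) (hb : b ≤ 1)
    (habc : a + b = 1 + c) {F G : ℝ → ℝ≥0∞} (hF : Measurable F) (hG : Measurable G) :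
    recipNorm c (fun x => ∫⁻ y, F (x - y) * G y) ≤ recipNorm a F * recipNorm b G := by
  have hmp : ∀ x : ℝ, MeasurePreserving (fun y => x - y) volume volume :=
    fun x => Measure.measurePreserving_sub_left volume x
  have hFx : ∀ x : ℝ, Measurable fun y => F (x - y) := fun x => hF.comp (by fun_prop)
  rcases hc.eq_or_lt with rfl | hc
  · rw [recipNorm_zero]
    refine essSup_le_of_ae_le _ (Filter.Eventually.of_forall fun x => ?_)
    refine (lintegral_mul_le_recipNorm (by linarith : 0 ≤ a) (by linarith : 0 ≤ b)
      (by linarith) (hFx x)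
      hG).trans_eq ?_
    rw [recipNorm_comp_measurePreserving (hmp x) a hF]
  have ha₀ : 0 < a := by linarith
  have hb₀ : 0 < b := by linarith
  rw [recipNorm_of_pos hc, recipNorm_of_pos ha₀, recipNorm_of_pos hb₀]
  set f : ℝ → ℝ≥0∞ := fun x => F x ^ (1 / a) with hf
  set g : ℝ → ℝ≥0∞ := fun x => G x ^ (1 / b) with hg
  have hfm : Measurable f := hF.pow_const _
  have hgm : Measurable g := hG.pow_const _
  have hFf : ∀ x, F x = f x ^ c * f x ^ (a - c) := by
    intro x
    rw [← ENNReal.rpow_add_of_nonneg _ _ hc.le (by linarith), ← ENNReal.rpow_mul]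
    simp [ha₀.ne']
  have hGg : ∀ x, G x = g x ^ c * g x ^ (b - c) := by
    intro x
    rw [← ENNReal.rpow_add_of_nonneg _ _ hc.le (by linarith), ← ENNReal.rpow_mul]
    simp [hb₀.ne']
  have hconv : ∀ x, ∫⁻ y, F (x - y) * G y ≤
      (∫⁻ y, f (x - y) * g y) ^ c * ((∫⁻ y, f y) ^ (a - c) * (∫⁻ y, g y) ^ (b - c)) := by
    intro x
    have hfx : Measurable fun y => f (x - y) := hfm.comp (by fun_prop)
    have := ENNReal.lintegral_prod_norm_pow_le (μ := volume) (Finset.univ : Finset (Fin 3))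
      (f := ![fun y => f (x - y) * g y, fun y => f (x - y), g])
      (by
        intro i _
        fin_cases i
        · exact (hfx.mul hgm).aemeasurable
        · exact hfx.aemeasurable
        · exact hgm.aemeasurable)
      (p := ![c, a - c, b - c])
      (by simp [Fin.sum_univ_three]; linarith)
      (by
        intro i _
        fin_cases i
        · exact hc.le
        · simp; linarith
        · simp; linarith)
    simp only [Fin.prod_univ_three, Matrix.cons_val_zero, Matrix.cons_val_one,
      Matrix.cons_val] at this
    rw [lintegral_sub_left_eq_self (fun y => f y) x, mul_assoc] at this
    refine le_trans (le_of_eq ?_) this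
    congr 1 with y
    rw [hFf, hGg, ENNReal.mul_rpow_of_nonneg _ _ hc.le]
    ring
  calc (∫⁻ x, (∫⁻ y, F (x - y) * G y) ^ (1 / c)) ^ c
      ≤ (∫⁻ x, (∫⁻ y, f (x - y) * g y) *
          ((∫⁻ y, f y) ^ (a - c) * (∫⁻ y, g y) ^ (b - c)) ^ (1 / c)) ^ c := by
        gcongr with x
        refine (ENNReal.rpow_le_rpow (hconv x) (by positivity)).trans_eq ?_
        rw [ENNReal.mul_rpow_of_nonneg _ _ (by positivity), ← ENNReal.rpow_mul,
          mul_one_div_cancel hc.ne', ENNReal.rpow_one]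
    _ = ((∫⁻ y, f y) * (∫⁻ y, g y)) ^ c *
          ((∫⁻ y, f y) ^ (a - c) * (∫⁻ y, g y) ^ (b - c)) := by
        have hm : Measurable (Function.uncurry fun x y => f (x - y) * g y) :=
          (hfm.comp (measurable_fst.sub measurable_snd)).mul (hgm.comp measurable_snd)
        have hm' : Measurable fun x => ∫⁻ y, f (x - y) * g y := hm.lintegral_prod_right'
        rw [lintegral_mul_const _ hm',
          ENNReal.mul_rpow_of_nonneg _ _ hc.le, ← ENNReal.rpow_mul, one_div_mul_cancel hc.ne',
          ENNReal.rpow_one, lintegral_lintegral_swap hm.aemeasurable]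
        congr 2
        have : ∀ y, ∫⁻ x, f (x - y) * g y = (∫⁻ x, f x) * g y := fun y => by
          have hfy : Measurable fun x => f (x - y) := hfm.comp (by fun_prop)
          rw [lintegral_mul_const _ hfy, lintegral_sub_right_eq_self (fun x => f x) y]
        simp_rw [this]
        rw [lintegral_const_mul _ hgm]
    _ = _ := by
        rw [ENNReal.mul_rpow_of_nonneg _ _ hc.le]
        rw [show ∀ p q r s : ℝ≥0∞, p * q * (r * s) = (p * r) * (q * s) by intros; ring,
          ← ENNReal.rpow_add_of_nonneg _ _ hc.le (by linarith),
          ← ENNReal.rpow_add_of_nonneg _ _ hc.le (by linarith)]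
        simp

/-- The kernel `1 / (1 + |u|)`. -/
def decay (u : ℝ) : ℝ≥0∞ := ENNReal.ofReal ((1 + |u|)⁻¹)

theorem measurable_decay : Measurable decay := by
  unfold decay
  fun_prop

theorem decay_neg (u : ℝ) : decay (-u) = decay u := by simp [decay]

theorem decay_half_le (u : ℝ) : decay (u / 2) ≤ 2 * decay u := by
  unfold decay
  rw [show (2 : ℝ≥0∞) = ENNReal.ofReal 2 by simp, ← ENNReal.ofReal_mul zero_le_two]
  refine ENNReal.ofReal_le_ofReal ?_
  have hu := abs_nonneg u
  rw [abs_div, abs_two, ← div_eq_mul_inv, inv_eq_one_div, div_le_div_iff₀ (by positivity)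
    (by positivity)]
  linarith

theorem recipNorm_decay_ne_top {θ : ℝ} (h₀ : 0 ≤ θ) (h₁ : θ < 1) : recipNorm θ decay ≠ ∞ := by
  rcases h₀.eq_or_lt with rfl | h₀
  · rw [recipNorm_zero]
    refine ((essSup_le_of_ae_le 1 (Filter.Eventually.of_forall fun u => ?_)).trans_lt
      ENNReal.one_lt_top).ne
    refine ENNReal.ofReal_le_one.mpr (inv_le_one_of_one_le₀ ?_)
    linarith [abs_nonneg u]
  · rw [recipNorm_of_pos h₀]
    refine ENNReal.rpow_ne_top_of_nonneg h₀.le ?_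
    have h : (Module.finrank ℝ ℝ : ℝ) < 1 / θ := by
      rw [Module.finrank_self, Nat.cast_one, lt_div_iff₀ h₀]
      linarith
    refine ne_of_eq_of_ne ?_ (finite_integral_one_add_norm (μ := volume) h).ne
    congr 1 with u
    have hu : 0 < 1 + |u| := by positivity
    rw [decay, ENNReal.ofReal_rpow_of_nonneg (by positivity) (by positivity),
      Real.inv_rpow hu.le, Real.rpow_neg (by positivity), Real.norm_eq_abs]

/-- The Gaussian `e^{-k x²}`. -/
def expSq (k x : ℝ) : ℝ≥0∞ := ENNReal.ofReal (Real.exp (-k * x ^ 2))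

theorem measurable_expSq (k : ℝ) : Measurable (expSq k) := by
  unfold expSq
  fun_prop

theorem recipNorm_expSq_ne_top {k θ : ℝ} (hk : 0 < k) (h₀ : 0 ≤ θ) :
    recipNorm θ (expSq k) ≠ ∞ := by
  rcases h₀.eq_or_lt with rfl | h₀
  · rw [recipNorm_zero]
    refine ((essSup_le_of_ae_le 1 (Filter.Eventually.of_forall fun u => ?_)).trans_lt
      ENNReal.one_lt_top).ne
    refine ENNReal.ofReal_le_one.mpr (Real.exp_le_one_iff.mpr ?_)
    nlinarith [sq_nonneg u]
  · rw [recipNorm_of_pos h₀]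
    refine ENNReal.rpow_ne_top_of_nonneg h₀.le ?_
    have h := (integrable_exp_neg_mul_sq (b := k * (1 / θ)) (by positivity)).lintegral_lt_top
    refine ne_of_eq_of_ne ?_ h.ne
    congr 1 with u
    rw [expSq, ENNReal.ofReal_rpow_of_nonneg (by positivity) (by positivity), ← Real.exp_mul]
    congr 2
    ring

/-- The bilinear fractional-integral type average `∫ F(x - v) G(x + v) / (1 + |v|) dv`. -/
def midConv (F G : ℝ → ℝ≥0∞) (x : ℝ) : ℝ≥0∞ := ∫⁻ v, F (x - v) * G (x + v) * decay v

theorem midConv_comm (F G : ℝ → ℝ≥0∞) : midConv F G = midConv G F := by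
  ext x
  unfold midConv
  rw [← lintegral_sub_left_eq_self _ 0]
  congr 1 with v
  rw [zero_sub, decay_neg, sub_neg_eq_add, ← sub_eq_add_neg, mul_comm (F _)]

theorem measurable_midConv {F G : ℝ → ℝ≥0∞} (hF : Measurable F) (hG : Measurable G) :
    Measurable (midConv F G) := by
  have h : Measurable (Function.uncurry fun x v : ℝ => F (x - v) * G (x + v) * decay v) :=
    ((hF.comp (measurable_fst.sub measurable_snd)).mul
      (hG.comp (measurable_fst.add measurable_snd))).mul (measurable_decay.comp measurable_snd)
  exact h.lintegral_prod_right'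

theorem lintegral_reflect_decay (G : ℝ → ℝ≥0∞) (x : ℝ) :
    ∫⁻ v, G (x + v) * decay v = ∫⁻ v, G (x - v) * decay v := by
  rw [← lintegral_sub_left_eq_self _ 0]
  congr 1 with v
  rw [zero_sub, decay_neg, ← sub_eq_add_neg]

theorem recipNorm_midConv_le_of_zero {b c : ℝ} (hc : 0 ≤ c) (hb : b ≤ 1) (hbc : c < b)
    {F G : ℝ → ℝ≥0∞} (hG : Measurable G) :
    recipNorm c (midConv F G) ≤
      recipNorm (1 + c - b) decay * (recipNorm 0 F * recipNorm b G) := by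
  have hm : Measurable fun x => ∫⁻ v, G (x - v) * decay v := by
    have : Measurable (Function.uncurry fun x v : ℝ => G (x - v) * decay v) :=
      (hG.comp (measurable_fst.sub measurable_snd)).mul (measurable_decay.comp measurable_snd)
    exact this.lintegral_prod_right'
  calc recipNorm c (midConv F G)
      ≤ recipNorm c (fun x => recipNorm 0 F * ∫⁻ v, G (x - v) * decay v) := by
        refine recipNorm_mono hc fun x => ?_
        have hGx : Measurable fun v => G (x + v) * decay v :=
          (hG.comp (by fun_prop)).mul measurable_decay
        rw [← lintegral_reflect_decay, ← lintegral_const_mul _ hGx, midConv]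
        refine lintegral_mono_ae ?_
        have h := (Measure.measurePreserving_sub_left volume x).quasiMeasurePreserving.ae
          (ENNReal.ae_le_essSup F)
        filter_upwards [h] with v hv
        rw [mul_assoc, recipNorm_zero]
        gcongr
    _ = recipNorm 0 F * recipNorm c (fun x => ∫⁻ v, G (x - v) * decay v) :=
        recipNorm_const_mul hc _ hm
    _ ≤ recipNorm 0 F * (recipNorm b G * recipNorm (1 + c - b) decay) := by
        gcongr
        exact recipNorm_convolution_le hc hb (by linarith) (by ring) hG measurable_decay
    _ = _ := by ring

theorem recipNorm_midConv_le {a b c : ℝ} (ha : 0 ≤ a) (hb : 0 ≤ b) (hc : 0 ≤ c)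
    (hab : a + b ≤ 1) (habc : c < a + b) {F G : ℝ → ℝ≥0∞} (hF : Measurable F)
    (hG : Measurable G) :
    recipNorm c (midConv F G) ≤
      recipNorm (1 + c - (a + b)) decay * (recipNorm a F * recipNorm b G) := by
  rcases ha.eq_or_lt with rfl | ha
  · rw [zero_add] at *
    exact recipNorm_midConv_le_of_zero hc hab habc hG
  rcases hb.eq_or_lt with rfl | hb
  · rw [add_zero] at *
    rw [midConv_comm, mul_comm (recipNorm a F)]
    exact recipNorm_midConv_le_of_zero hc hab habc hF
  have hs : 0 < a + b := by positivity
  set W := recipNorm (1 + c - (a + b)) decay with hW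
  set θ := a / (a + b) with hθ
  have hθ₀ : 0 < θ := by positivity
  have hθ' : 1 - θ = b / (a + b) := by rw [hθ]; field_simp; ring
  have hθ₁ : 0 < 1 - θ := by rw [hθ']; positivity
  set f : ℝ → ℝ≥0∞ := fun x => F x ^ (1 / θ) with hf
  set g : ℝ → ℝ≥0∞ := fun x => G x ^ (1 / (1 - θ)) with hg
  have hfm : Measurable f := hF.pow_const _
  have hgm : Measurable g := hG.pow_const _
  have hconv : ∀ {h : ℝ → ℝ≥0∞}, Measurable h →
      Measurable fun x => ∫⁻ v, h (x - v) * decay v := by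
    intro h hh
    have : Measurable (Function.uncurry fun x v : ℝ => h (x - v) * decay v) :=
      (hh.comp (measurable_fst.sub measurable_snd)).mul (measurable_decay.comp measurable_snd)
    exact this.lintegral_prod_right'
  have hpt : ∀ x, midConv F G x ≤
      (∫⁻ v, f (x - v) * decay v) ^ θ * (∫⁻ v, g (x - v) * decay v) ^ (1 - θ) := by
    intro x
    have hfx : Measurable fun v => f (x - v) * decay v :=
      (hfm.comp (by fun_prop)).mul measurable_decay
    have hgx : Measurable fun v => g (x + v) * decay v :=
      (hgm.comp (by fun_prop)).mul measurable_decay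
    rw [← lintegral_reflect_decay g]
    refine le_trans (le_of_eq ?_) (ENNReal.lintegral_mul_norm_pow_le hfx.aemeasurable
      hgx.aemeasurable hθ₀.le hθ₁.le (by ring))
    unfold midConv
    congr 1 with v
    rw [ENNReal.mul_rpow_of_nonneg _ _ hθ₀.le, ENNReal.mul_rpow_of_nonneg _ _ hθ₁.le,
      ← ENNReal.rpow_mul, ← ENNReal.rpow_mul, one_div_mul_cancel hθ₀.ne',
      one_div_mul_cancel hθ₁.ne', ENNReal.rpow_one, ENNReal.rpow_one]
    have hd : decay v = decay v ^ θ * decay v ^ (1 - θ) := by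
      rw [← ENNReal.rpow_add_of_nonneg _ _ hθ₀.le hθ₁.le]
      simp
    conv_lhs => rw [hd]
    ring
  have hX : recipNorm c (fun x => ∫⁻ v, f (x - v) * decay v) ≤
      recipNorm a F ^ (1 / θ) * W := by
    refine (recipNorm_convolution_le (a := a + b) (b := 1 + c - (a + b)) hc hab (by linarith)
      (by ring) hfm
      measurable_decay).trans_eq ?_
    rw [hf, recipNorm_rpow hs (by positivity)]
    congr 3
    rw [hθ]; field_simp
  have hY : recipNorm c (fun x => ∫⁻ v, g (x - v) * decay v) ≤
      recipNorm b G ^ (1 / (1 - θ)) * W := by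
    refine (recipNorm_convolution_le (a := a + b) (b := 1 + c - (a + b)) hc hab (by linarith)
      (by ring) hgm
      measurable_decay).trans_eq ?_
    rw [hg, recipNorm_rpow hs (by positivity)]
    congr 3
    rw [hθ']; field_simp
  calc recipNorm c (midConv F G)
      ≤ _ := recipNorm_mono hc hpt
    _ ≤ _ := recipNorm_geom_mean_le hc hθ₀.le (by linarith) (hconv hfm) (hconv hgm)
    _ ≤ (recipNorm a F ^ (1 / θ) * W) ^ θ * (recipNorm b G ^ (1 / (1 - θ)) * W) ^ (1 - θ) := by
        gcongr
    _ = W ^ θ * W ^ (1 - θ) * (recipNorm a F * recipNorm b G) := by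
        rw [ENNReal.mul_rpow_of_nonneg _ _ hθ₀.le, ENNReal.mul_rpow_of_nonneg _ _ hθ₁.le,
          ← ENNReal.rpow_mul, ← ENNReal.rpow_mul, one_div_mul_cancel hθ₀.ne',
          one_div_mul_cancel hθ₁.ne', ENNReal.rpow_one, ENNReal.rpow_one]
        ring
    _ = _ := by
        rw [← ENNReal.rpow_add_of_nonneg _ _ hθ₀.le hθ₁.le]
        simp

theorem lintegral_prod_eq_mid {h : ℝ × ℝ → ℝ≥0∞} (hh : Measurable h) :
    ∫⁻ s, h s = 2 * ∫⁻ x, ∫⁻ v, h (x - v, x + v) := by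
  have hscale : ∀ k : ℝ → ℝ≥0∞, Measurable k → ∫⁻ y, k y = 2 * ∫⁻ v, k (2 * v) := by
    intro k hk
    have h2 : ENNReal.ofReal |(2 : ℝ)⁻¹| = 2⁻¹ := by
      rw [abs_of_pos (by norm_num), ENNReal.ofReal_inv_of_pos two_pos]
      simp
    rw [← lintegral_map hk (by fun_prop : Measurable fun v : ℝ => 2 * v),
      Real.map_volume_mul_left two_ne_zero, lintegral_smul_measure, h2, smul_eq_mul, ← mul_assoc,
      ENNReal.mul_inv_cancel two_ne_zero ENNReal.ofNat_ne_top, one_mul]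
  have hm₁ : Measurable (Function.uncurry fun x v : ℝ => h (x, x + 2 * v)) :=
    hh.comp (by fun_prop)
  have hm₂ : Measurable (Function.uncurry fun x v : ℝ => h (x - v, x + v)) :=
    hh.comp (by fun_prop)
  calc ∫⁻ s, h s = ∫⁻ x, ∫⁻ y, h (x, y) := lintegral_prod _ hh.aemeasurable
    _ = ∫⁻ x, 2 * ∫⁻ v, h (x, x + 2 * v) := by
        congr 1 with x
        have hx : Measurable fun y => h (x, x + y) := hh.comp (by fun_prop)
        rw [← lintegral_add_left_eq_self _ x, hscale _ hx]
    _ = 2 * ∫⁻ x, ∫⁻ v, h (x, x + 2 * v) := by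
        have : Measurable fun x => ∫⁻ v, h (x, x + 2 * v) := hm₁.lintegral_prod_right'
        rw [lintegral_const_mul _ this]
    _ = _ := by
        rw [lintegral_lintegral_swap hm₁.aemeasurable, lintegral_lintegral_swap hm₂.aemeasurable]
        congr 2 with v
        rw [← lintegral_sub_right_eq_self _ v]
        congr 1 with x
        congr 2
        ring

/-- The time part of the phase-space kernel of the bilinear Hilbert transform, acting on a pair
of functions. -/
def timeForm (k : ℝ) (F G : ℝ → ℝ≥0∞) (t : ℝ) : ℝ≥0∞ :=
  ∫⁻ s : ℝ × ℝ, F s.1 * G s.2 * (expSq k (t - (s.1 + s.2) / 2) * decay ((s.1 - s.2) / 2))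

theorem exists_recipNorm_timeForm_le {k a b c : ℝ} (hk : 0 < k) (ha₀ : 0 ≤ a) (ha : a ≤ 1)
    (hb₀ : 0 ≤ b) (hb : b ≤ 1) (hc₀ : 0 ≤ c) (hc : c ≤ 1) (habc : c < a + b) :
    ∃ K : ℝ≥0∞, K ≠ ∞ ∧ ∀ F G : ℝ → ℝ≥0∞, Measurable F → Measurable G →
      recipNorm c (timeForm k F G) ≤ K * (recipNorm a F * recipNorm b G) := by
  have hEm := measurable_expSq k
  have hDm := measurable_decay
  rcases le_or_gt (a + b) 1 with hab | hab
  · refine ⟨2 * recipNorm 1 (expSq k) * recipNorm (1 + c - (a + b)) decay,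
      ENNReal.mul_ne_top (ENNReal.mul_ne_top ENNReal.ofNat_ne_top
        (recipNorm_expSq_ne_top hk zero_le_one))
        (recipNorm_decay_ne_top (by linarith) (by linarith)), fun F G hF hG => ?_⟩
    have hBm := measurable_midConv hF hG
    have hT : ∀ t, timeForm k F G t = 2 * ∫⁻ x, expSq k (t - x) * midConv F G x := by
      intro t
      have hm : Measurable fun s : ℝ × ℝ => F s.1 * G s.2 *
          (expSq k (t - (s.1 + s.2) / 2) * decay ((s.1 - s.2) / 2)) :=
        ((hF.comp measurable_fst).mul (hG.comp measurable_snd)).mul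
          ((hEm.comp (by fun_prop)).mul (hDm.comp (by fun_prop)))
      rw [timeForm, lintegral_prod_eq_mid hm]
      congr 2 with x
      have hmx : Measurable fun v => F (x - v) * G (x + v) * decay v :=
        ((hF.comp (by fun_prop)).mul (hG.comp (by fun_prop))).mul hDm
      rw [midConv, ← lintegral_const_mul _ hmx]
      congr 1 with v
      rw [show (x - v + (x + v)) / 2 = x by ring, show (x - v - (x + v)) / 2 = -v by ring,
        decay_neg]
      ring
    have hm : Measurable fun t => ∫⁻ x, expSq k (t - x) * midConv F G x := by
      have : Measurable (Function.uncurry fun t x : ℝ => expSq k (t - x) * midConv F G x) :=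
        (hEm.comp (measurable_fst.sub measurable_snd)).mul (hBm.comp measurable_snd)
      exact this.lintegral_prod_right'
    calc recipNorm c (timeForm k F G)
        = 2 * recipNorm c (fun t => ∫⁻ x, expSq k (t - x) * midConv F G x) := by
          rw [← recipNorm_const_mul hc₀ _ hm]
          congr 1 with t
          exact hT t
      _ ≤ 2 * (recipNorm 1 (expSq k) * recipNorm c (midConv F G)) := by
          gcongr
          exact recipNorm_convolution_le hc₀ le_rfl hc rfl hEm hBm
      _ ≤ 2 * (recipNorm 1 (expSq k) *
            (recipNorm (1 + c - (a + b)) decay * (recipNorm a F * recipNorm b G))) := by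
          gcongr
          exact recipNorm_midConv_le ha₀ hb₀ hc₀ hab habc hF hG
      _ = _ := by ring
  · refine ⟨2 * recipNorm c (expSq k) * recipNorm (2 - a - b) decay,
      ENNReal.mul_ne_top (ENNReal.mul_ne_top ENNReal.ofNat_ne_top
        (recipNorm_expSq_ne_top hk hc₀))
        (recipNorm_decay_ne_top (by linarith) (by linarith)), fun F G hF hG => ?_⟩
    set E := recipNorm c (expSq k) with hE
    have hCm : Measurable fun x => ∫⁻ y, decay (x - y) * G y := by
      have : Measurable (Function.uncurry fun x y : ℝ => decay (x - y) * G y) :=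
        (hDm.comp (measurable_fst.sub measurable_snd)).mul (hG.comp measurable_snd)
      exact this.lintegral_prod_right'
    have hM : Measurable fun s : ℝ × ℝ => 2 * E * (F s.1 * (decay (s.1 - s.2) * G s.2)) :=
      ((hF.comp measurable_fst).mul ((hDm.comp (measurable_fst.sub measurable_snd)).mul
        (hG.comp measurable_snd))).const_mul _
    calc recipNorm c (timeForm k F G)
        ≤ ∫⁻ s : ℝ × ℝ, 2 * E * (F s.1 * (decay (s.1 - s.2) * G s.2)) := by
          refine recipNorm_lintegral_le hc₀ hc ?_ hM fun s => ?_
          · exact ((hF.comp (by fun_prop)).mul (hG.comp (by fun_prop))).mul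
              ((hEm.comp (by fun_prop)).mul (hDm.comp (by fun_prop)))
          · have hmp := measurePreserving_sub_right volume ((s.1 + s.2) / 2)
            calc recipNorm c (fun t => F s.1 * G s.2 *
                  (expSq k (t - (s.1 + s.2) / 2) * decay ((s.1 - s.2) / 2)))
                = recipNorm c (fun t => F s.1 * G s.2 * decay ((s.1 - s.2) / 2) *
                    expSq k (t - (s.1 + s.2) / 2)) := by
                  congr 1 with t
                  ring
              _ = F s.1 * G s.2 * decay ((s.1 - s.2) / 2) * E := by
                  have hEs : Measurable fun t => expSq k (t - (s.1 + s.2) / 2) :=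
                    hEm.comp (by fun_prop)
                  rw [recipNorm_const_mul hc₀ _ hEs,
                    recipNorm_comp_measurePreserving hmp c hEm]
              _ ≤ F s.1 * G s.2 * (2 * decay (s.1 - s.2)) * E := by
                  gcongr
                  exact decay_half_le _
              _ = _ := by ring
      _ = 2 * E * ∫⁻ x, F x * ∫⁻ y, decay (x - y) * G y := by
          have hM' : Measurable fun s : ℝ × ℝ => F s.1 * (decay (s.1 - s.2) * G s.2) :=
            (hF.comp measurable_fst).mul ((hDm.comp (measurable_fst.sub measurable_snd)).mul
              (hG.comp measurable_snd))
          rw [lintegral_const_mul _ hM']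
          congr 1
          refine (lintegral_prod _ hM'.aemeasurable).trans ?_
          congr 1 with x
          have hx : Measurable fun y => decay (x - y) * G y := (hDm.comp (by fun_prop)).mul hG
          exact lintegral_const_mul (F x) hx
      _ ≤ 2 * E * (recipNorm a F * (recipNorm (2 - a - b) decay * recipNorm b G)) := by
          gcongr
          refine (lintegral_mul_le_recipNorm ha₀ (by linarith : 0 ≤ 1 - a) (by ring) hF
            hCm).trans ?_
          gcongr
          exact recipNorm_convolution_le (by linarith) (by linarith) hb (by ring) hDm hG
      _ = _ := by ring

theorem exists_recipNorm_freqForm_le {k a b c : ℝ} (hk : 0 < k) (ha : a ≤ 1)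
    (hb : b ≤ 1) (hc₀ : 0 ≤ c) (habc : 1 + c ≤ a + b) :
    ∃ K : ℝ≥0∞, K ≠ ∞ ∧ ∀ X Y : ℝ → ℝ≥0∞, Measurable X → Measurable Y →
      recipNorm c (fun ν => ∫⁻ ω : ℝ × ℝ, expSq k (ν - (ω.1 + ω.2)) * (X ω.1 * Y ω.2)) ≤
        K * (recipNorm a X * recipNorm b Y) := by
  refine ⟨recipNorm (2 + c - (a + b)) (expSq k),
    recipNorm_expSq_ne_top hk (by linarith), fun X Y hX hY => ?_⟩
  have hEm := measurable_expSq k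
  have hm : Measurable (Function.uncurry fun y z : ℝ => X (y - z) * Y z) :=
    (hX.comp (measurable_fst.sub measurable_snd)).mul (hY.comp measurable_snd)
  have hZ : Measurable fun y => ∫⁻ z, X (y - z) * Y z := hm.lintegral_prod_right'
  have heq : ∀ ν, ∫⁻ ω : ℝ × ℝ, expSq k (ν - (ω.1 + ω.2)) * (X ω.1 * Y ω.2) =
      ∫⁻ y, expSq k (ν - y) * ∫⁻ z, X (y - z) * Y z := by
    intro ν
    have hm₁ : Measurable fun ω : ℝ × ℝ => expSq k (ν - (ω.1 + ω.2)) * (X ω.1 * Y ω.2) :=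
      (hEm.comp (by fun_prop)).mul ((hX.comp measurable_fst).mul (hY.comp measurable_snd))
    have hm₂ : Measurable (Function.uncurry fun y z : ℝ => expSq k (ν - y) * (X (y - z) * Y z)) :=
      (hEm.comp (by fun_prop)).mul hm
    refine (lintegral_prod_symm _ hm₁.aemeasurable).trans ?_
    calc ∫⁻ z, ∫⁻ x, expSq k (ν - (x + z)) * (X x * Y z)
        = ∫⁻ z, ∫⁻ y, expSq k (ν - y) * (X (y - z) * Y z) := by
          congr 1 with z
          rw [← lintegral_sub_right_eq_self _ z]
          simp only [sub_add_cancel]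
      _ = ∫⁻ y, ∫⁻ z, expSq k (ν - y) * (X (y - z) * Y z) :=
          (lintegral_lintegral_swap hm₂.aemeasurable).symm
      _ = _ := by
          congr 1 with y
          have hy : Measurable fun z => X (y - z) * Y z := (hX.comp (by fun_prop)).mul hY
          exact lintegral_const_mul _ hy
  simp_rw [heq]
  refine (recipNorm_convolution_le (a := 2 + c - (a + b)) (b := a + b - 1) hc₀ (by linarith)
    (by linarith) (by ring) hEm hZ).trans ?_
  gcongr
  exact recipNorm_convolution_le (c := a + b - 1) (by linarith) ha hb (by ring) hX hY

theorem e2pi_eq_exp_mul_I (a : ℝ) : e2pi a = Complex.exp (((2 * Real.pi * a : ℝ) : ℂ) * I) := by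
  unfold e2pi
  congr 1
  push_cast
  ring

theorem norm_e2pi (a : ℝ) : ‖e2pi a‖ = 1 := by
  rw [e2pi_eq_exp_mul_I, Complex.norm_exp_ofReal_mul_I]

theorem e2pi_add (a b : ℝ) : e2pi (a + b) = e2pi a * e2pi b := by
  rw [e2pi, e2pi, e2pi, ← Complex.exp_add]
  congr 1
  push_cast
  ring

@[fun_prop]
theorem continuous_e2pi : Continuous e2pi := by
  unfold e2pi
  fun_prop

@[fun_prop]
theorem continuous_gauss1 : Continuous gauss1 := by
  unfold gauss1
  fun_prop

theorem integrable_gauss1 : Integrable gauss1 := by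
  have h := (integrable_exp_neg_mul_sq (b := 1) one_pos).ofReal (𝕜 := ℂ)
  refine h.congr (Filter.Eventually.of_forall fun x => ?_)
  simp [gauss1]

theorem norm_gauss1_le_one (x : ℝ) : ‖gauss1 x‖ ≤ 1 := by
  rw [gauss1, Complex.norm_real, Real.norm_of_nonneg (Real.exp_pos _).le]
  exact Real.exp_le_one_iff.mpr (by nlinarith [sq_nonneg x])

/-- Up to the factor `√π`, the Fourier transform of the Gaussian window. -/
def freqGauss (ξ : ℝ) : ℝ := Real.exp (-(Real.pi ^ 2 * ξ ^ 2))

@[fun_prop]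
theorem continuous_freqGauss : Continuous freqGauss := by
  unfold freqGauss
  fun_prop

theorem freqGauss_neg (ξ : ℝ) : freqGauss (-ξ) = freqGauss ξ := by simp [freqGauss]

theorem freqGauss_pos (ξ : ℝ) : 0 < freqGauss ξ := Real.exp_pos _

theorem freqGauss_le_one (ξ : ℝ) : freqGauss ξ ≤ 1 :=
  Real.exp_le_one_iff.mpr (neg_nonpos.mpr (by positivity))

theorem integrable_freqGauss : Integrable freqGauss := by
  refine (integrable_exp_neg_mul_sq (b := Real.pi ^ 2) (by positivity)).congr
    (Filter.Eventually.of_forall fun x => ?_)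
  simp [freqGauss]

theorem integral_gauss1_mul_e2pi (ξ : ℝ) :
    ∫ y, gauss1 y * e2pi (y * ξ) = (√Real.pi : ℂ) * freqGauss ξ := by
  have h := integral_cexp_quadratic (b := -1) (by simp) (2 * Real.pi * I * ξ) 0
  have hpi : ((√Real.pi : ℝ) : ℂ) = (Real.pi : ℂ) ^ (1 / 2 : ℂ) := by
    rw [Real.sqrt_eq_rpow, Complex.ofReal_cpow Real.pi_pos.le]
    simp
  rw [hpi, freqGauss]
  convert h using 2
  · ext y
    rw [gauss1, e2pi, Complex.ofReal_exp, ← Complex.exp_add]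
    congr 1
    push_cast
    ring
  · simp
  · rw [Complex.ofReal_exp]
    congr 1
    push_cast
    linear_combination (-Real.pi ^ 2 * ξ ^ 2 : ℂ) * Complex.I_sq

theorem FT1_schwartz (f : SchwartzMap ℝ ℂ) : FT1 f = ⇑(FourierTransform.fourier f) := by
  ext ξ
  rw [SchwartzMap.fourier_coe, Real.fourier_eq', FT1]
  congr 1 with y
  rw [smul_eq_mul, mul_comm, e2pi_eq_exp_mul_I]
  congr 3
  simp
  ring

theorem integrable_FT1 (f : SchwartzMap ℝ ℂ) : Integrable (FT1 f) := by
  rw [FT1_schwartz]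
  exact SchwartzMap.integrable _

/-- The modulated short-time Fourier transform is a convolution. -/
theorem STFT1_mul_e2pi_eq_convolution (f : ℝ → ℂ) (ω ξ s : ℝ) :
    STFT1 gauss1 f s ω * e2pi (s * (ω - ξ)) =
      convolution (fun y => f y * e2pi (-(y * ξ))) (fun y => gauss1 y * e2pi (y * (ω - ξ)))
        (ContinuousLinearMap.mul ℂ ℂ) volume s := by
  rw [convolution_def, STFT1, ← integral_mul_const]
  congr 1 with y
  rw [ContinuousLinearMap.mul_apply',
    show s * (ω - ξ) = y * ω + -(y * ξ) + (s - y) * (ω - ξ) by ring,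
    e2pi_add, e2pi_add]
  have h : e2pi (-(y * ω)) * e2pi (y * ω) = 1 := by
    rw [← e2pi_add, neg_add_cancel]
    simp [e2pi]
  have hg : gauss1 (y - s) = gauss1 (s - y) := by
    unfold gauss1
    rw [← neg_sub s y, neg_sq]
  rw [hg]
  linear_combination (f y * gauss1 (s - y) * e2pi (-(y * ξ)) * e2pi ((s - y) * (ω - ξ))) * h

theorem integrable_mul_e2pi {f : ℝ → ℂ} (hf : Integrable f) {φ : ℝ → ℝ} (hφ : Continuous φ) :
    Integrable fun y => f y * e2pi (φ y) :=
  hf.mul_bdd (c := 1) (by fun_prop) (Filter.Eventually.of_forall fun y => (norm_e2pi _).le)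

theorem integrable_STFT1 {f : ℝ → ℂ} (hf : Integrable f) (ω : ℝ) :
    Integrable fun s => STFT1 gauss1 f s ω := by
  have h := Integrable.integrable_convolution (ContinuousLinearMap.mul ℂ ℂ)
    (integrable_mul_e2pi hf (φ := fun y => -(y * ω)) (by fun_prop))
    (integrable_mul_e2pi integrable_gauss1 (φ := fun y => y * (ω - ω)) (by fun_prop))
  refine h.congr (Filter.Eventually.of_forall fun s => ?_)
  dsimp only
  rw [← STFT1_mul_e2pi_eq_convolution]
  simp [e2pi]

theorem integral_STFT1_mul_e2pi {f : ℝ → ℂ} (hf : Integrable f) (ω ξ : ℝ) :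
    ∫ s, STFT1 gauss1 f s ω * e2pi (s * (ω - ξ)) =
      (√Real.pi : ℂ) * (FT1 f ξ * freqGauss (ξ - ω)) := by
  simp_rw [STFT1_mul_e2pi_eq_convolution]
  rw [integral_convolution _ (integrable_mul_e2pi hf (φ := fun y => -(y * ξ)) (by fun_prop))
    (integrable_mul_e2pi integrable_gauss1 (φ := fun y => y * (ω - ξ)) (by fun_prop)),
    ContinuousLinearMap.mul_apply', integral_gauss1_mul_e2pi, ← freqGauss_neg (ξ - ω), neg_sub, FT1]
  ring

theorem continuous_STFT1 {f : ℝ → ℂ} (hf : Integrable f) :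
    Continuous fun z : ℝ × ℝ => STFT1 gauss1 f z.1 z.2 := by
  unfold STFT1
  refine continuous_of_dominated (bound := fun y => ‖f y‖) (fun z => ?_) (fun z => ?_) hf.norm ?_
  · exact ((hf.aestronglyMeasurable.mul
      (by fun_prop : Continuous fun y => e2pi (-(y * z.2))).aestronglyMeasurable).mul
      (by fun_prop : Continuous fun y => gauss1 (y - z.1)).aestronglyMeasurable)
  · refine Filter.Eventually.of_forall fun y => ?_
    rw [norm_mul, norm_mul, norm_e2pi, mul_one]
    exact mul_le_of_le_one_right (norm_nonneg _) (norm_gauss1_le_one _)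
  · refine Filter.Eventually.of_forall fun y => ?_
    fun_prop

theorem measurable_sign : Measurable Real.sign := by
  unfold Real.sign
  exact Measurable.ite measurableSet_Iio measurable_const
    (Measurable.ite measurableSet_Ioi measurable_const measurable_const)

theorem abs_sign_le_one (x : ℝ) : |Real.sign x| ≤ 1 := by
  rcases Real.sign_apply_eq x with h | h | h <;> simp [h]

/-- The Gaussian `e^{-π²x²/2}`. -/
def halfGauss (x : ℝ) : ℝ := Real.exp (-(Real.pi ^ 2 / 2 * x ^ 2))

@[fun_prop]
theorem continuous_halfGauss : Continuous halfGauss := by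
  unfold halfGauss
  fun_prop

theorem integrable_halfGauss : Integrable halfGauss := by
  refine (integrable_exp_neg_mul_sq (b := Real.pi ^ 2 / 2) (by positivity)).congr
    (Filter.Eventually.of_forall fun x => ?_)
  simp [halfGauss]

theorem hasDerivAt_halfGauss (x : ℝ) :
    HasDerivAt halfGauss (-(Real.pi ^ 2 * x) * halfGauss x) x := by
  have h := (((hasDerivAt_id x).pow 2).const_mul (Real.pi ^ 2 / 2)).neg.exp
  refine h.congr_deriv ?_
  simp [halfGauss]
  ring

theorem integrable_deriv_halfGauss :
    Integrable fun x => -(Real.pi ^ 2 * x) * halfGauss x := by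
  refine ((integrable_mul_exp_neg_mul_sq (b := Real.pi ^ 2 / 2) (by positivity)).const_mul
    (-Real.pi ^ 2)).congr (Filter.Eventually.of_forall fun x => ?_)
  simp [halfGauss]
  ring

theorem freqGauss_mul_freqGauss (a b : ℝ) :
    freqGauss a * freqGauss b = halfGauss (a + b) * halfGauss (a - b) := by
  simp only [freqGauss, halfGauss, ← Real.exp_add]
  congr 1
  ring

theorem halfGauss_le_one (x : ℝ) : halfGauss x ≤ 1 :=
  Real.exp_le_one_iff.mpr (neg_nonpos.mpr (by positivity))

theorem halfGauss_pos (x : ℝ) : 0 < halfGauss x := Real.exp_pos _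

theorem tendsto_halfGauss_cocompact : Filter.Tendsto halfGauss (Filter.cocompact ℝ) (nhds 0) := by
  have h : Filter.Tendsto (fun x : ℝ => Real.pi ^ 2 / 2 * x ^ 2) (Filter.cocompact ℝ)
      Filter.atTop := by
    have h1 : Filter.Tendsto (fun x : ℝ => x ^ 2) (Filter.cocompact ℝ) Filter.atTop := by
      have := (Filter.tendsto_pow_atTop (α := ℝ) two_ne_zero).comp
        (tendsto_norm_cocompact_atTop (E := ℝ))
      refine this.congr fun x => ?_
      simp
    exact h1.const_mul_atTop (by positivity)
  exact Real.tendsto_exp_neg_atTop_nhds_zero.comp h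

/-- The oscillatory integral `∫ sign(ζ) e^{-π²(ζ-Δ)²/2} e^{2πiζv} dζ` is `O(1/(1+|v|))`,
uniformly in `Δ`. -/
theorem exists_norm_integral_sign_halfGauss_le :
    ∃ C : ℝ, 0 ≤ C ∧ ∀ Δ v : ℝ,
      ‖∫ ζ : ℝ, ((Real.sign ζ * halfGauss (ζ - Δ) : ℝ) : ℂ) * e2pi (ζ * v)‖ ≤
        C * (1 + |v|)⁻¹ := by
  set N := ∫ x, ‖-(Real.pi ^ 2 * x) * halfGauss x‖ with hN
  set A := ∫ x, halfGauss x with hA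
  have hN₀ : 0 ≤ N := integral_nonneg fun x => norm_nonneg _
  have hA₀ : 0 ≤ A := integral_nonneg fun x => (halfGauss_pos _).le
  refine ⟨A + (2 + N), by positivity, fun Δ v => ?_⟩
  set J := ∫ ζ : ℝ, ((Real.sign ζ * halfGauss (ζ - Δ) : ℝ) : ℂ) * e2pi (ζ * v) with hJ
  set q : ℝ → ℂ := fun ζ => (halfGauss (ζ - Δ) : ℂ) * e2pi (ζ * v) with hq
  set q' : ℝ → ℂ := fun ζ =>
    ((-(Real.pi ^ 2 * (ζ - Δ)) * halfGauss (ζ - Δ) : ℝ) : ℂ) * e2pi (ζ * v) with hq'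
  have hqn : ∀ ζ, ‖q ζ‖ = halfGauss (ζ - Δ) := fun ζ => by
    simp only [hq]
    rw [norm_mul, norm_e2pi, mul_one, Complex.norm_real, Real.norm_of_nonneg (halfGauss_pos _).le]
  have hqi : Integrable q :=
    integrable_mul_e2pi (integrable_halfGauss.comp_sub_right Δ).ofReal (by fun_prop)
  have hqi' : Integrable q' :=
    integrable_mul_e2pi (integrable_deriv_halfGauss.comp_sub_right Δ).ofReal (by fun_prop)
  have hder : ∀ ζ, HasDerivAt q (q' ζ + 2 * Real.pi * I * v * q ζ) ζ := by
    intro ζ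
    have h1 : HasDerivAt (fun ζ : ℝ => (halfGauss (ζ - Δ) : ℂ)) _ ζ :=
      ((hasDerivAt_halfGauss (ζ - Δ)).comp_sub_const ζ Δ).ofReal_comp
    have h2 : HasDerivAt (fun ζ : ℝ => e2pi (ζ * v)) (e2pi (ζ * v) * (2 * Real.pi * I * v)) ζ := by
      unfold e2pi
      refine HasDerivAt.cexp ?_
      have := (((hasDerivAt_id ζ).mul_const v).ofReal_comp).const_mul (2 * Real.pi * I)
      simpa using this
    refine (h1.mul h2).congr_deriv ?_
    simp only [hq, hq']
    ring
  have hsum : Integrable fun ζ => q' ζ + 2 * Real.pi * I * v * q ζ :=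
    hqi'.add (hqi.const_mul _)
  have hcont : Continuous q := by
    simp only [hq]
    fun_prop
  have hlim : Filter.Tendsto q (Filter.cocompact ℝ) (nhds 0) := by
    rw [tendsto_zero_iff_norm_tendsto_zero]
    simp_rw [hqn]
    have h : Filter.Tendsto (fun ζ : ℝ => ζ - Δ) (Filter.cocompact ℝ) (Filter.cocompact ℝ) :=
      (Homeomorph.subRight Δ).isClosedEmbedding.tendsto_cocompact
    exact tendsto_halfGauss_cocompact.comp h
  have hIoi := integral_Ioi_of_hasDerivAt_of_tendsto (a := 0) hcont.continuousWithinAt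
    (fun ζ _ => hder ζ) hsum.integrableOn (hlim.mono_left atTop_le_cocompact)
  have hIic := integral_Iic_of_hasDerivAt_of_tendsto (a := 0) hcont.continuousWithinAt
    (fun ζ _ => hder ζ) hsum.integrableOn (hlim.mono_left atBot_le_cocompact)
  rw [integral_add hqi'.integrableOn (hqi.const_mul _).integrableOn, integral_const_mul]
    at hIoi hIic
  have hJi : Integrable fun ζ : ℝ =>
      ((Real.sign ζ * halfGauss (ζ - Δ) : ℝ) : ℂ) * e2pi (ζ * v) := by
    refine integrable_mul_e2pi ?_ (by fun_prop)
    refine ((integrable_halfGauss.comp_sub_right Δ).bdd_mul (c := 1)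
      measurable_sign.aestronglyMeasurable (Filter.Eventually.of_forall abs_sign_le_one)).ofReal
  have hJsplit : J = (∫ ζ in Set.Ioi 0, q ζ) - ∫ ζ in Set.Iic 0, q ζ := by
    rw [hJ, ← integral_add_compl measurableSet_Ioi hJi, Set.compl_Ioi, sub_eq_add_neg,
      ← integral_neg]
    congr 1
    · refine setIntegral_congr_fun measurableSet_Ioi fun ζ hζ => ?_
      simp only [hq]
      rw [Real.sign_of_pos hζ, one_mul]
    · rw [integral_Iic_eq_integral_Iio, integral_Iic_eq_integral_Iio]
      refine setIntegral_congr_fun measurableSet_Iio fun ζ hζ => ?_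
      simp only [hq]
      rw [Real.sign_of_neg hζ]
      push_cast
      ring
  have hJ₁ : ‖J‖ ≤ A := by
    rw [hA, ← integral_sub_right_eq_self _ Δ]
    refine norm_integral_le_of_norm_le (integrable_halfGauss.comp_sub_right Δ)
      (Filter.Eventually.of_forall fun ζ => ?_)
    rw [norm_mul, norm_e2pi, mul_one, Complex.norm_real, norm_mul,
      Real.norm_of_nonneg (halfGauss_pos _).le]
    exact mul_le_of_le_one_left (halfGauss_pos _).le (abs_sign_le_one _)
  have hq0 : ‖q 0‖ ≤ 1 := (hqn 0).trans_le (halfGauss_le_one _)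
  have hq'N : (∫ ζ in Set.Ioi 0, ‖q' ζ‖) + ∫ ζ in Set.Iic 0, ‖q' ζ‖ = N := by
    rw [← Set.compl_Ioi, integral_add_compl measurableSet_Ioi hqi'.norm, hN,
      ← integral_sub_right_eq_self (fun x => ‖-(Real.pi ^ 2 * x) * halfGauss x‖) Δ]
    congr 1 with ζ
    simp only [hq']
    rw [norm_mul, norm_e2pi, mul_one, Complex.norm_real]
  have hJ₂ : |v| * ‖J‖ ≤ 2 + N := by
    have heq : 2 * Real.pi * I * v * J =
        -2 * q 0 - (∫ ζ in Set.Ioi 0, q' ζ) + ∫ ζ in Set.Iic 0, q' ζ := by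
      rw [hJsplit]
      linear_combination hIoi - hIic
    have hnorm : 2 * Real.pi * (|v| * ‖J‖) ≤ 2 + N := by
      calc 2 * Real.pi * (|v| * ‖J‖) = ‖2 * Real.pi * I * v * J‖ := by
            simp [abs_of_pos Real.pi_pos]
            ring
        _ ≤ ‖-2 * q 0‖ + ‖∫ ζ in Set.Ioi 0, q' ζ‖ + ‖∫ ζ in Set.Iic 0, q' ζ‖ := by
            rw [heq]
            exact (norm_add_le _ _).trans (add_le_add_left (norm_sub_le _ _) _)
        _ ≤ 2 * 1 + (∫ ζ in Set.Ioi 0, ‖q' ζ‖) + ∫ ζ in Set.Iic 0, ‖q' ζ‖ := by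
            gcongr
            · rw [norm_mul]
              simpa using hq0
            · exact norm_integral_le_integral_norm _
            · exact norm_integral_le_integral_norm _
        _ = _ := by rw [add_assoc, hq'N, mul_one]
    have h0 : 0 ≤ |v| * ‖J‖ := by positivity
    nlinarith [Real.pi_gt_three]
  rw [← div_eq_mul_inv, le_div_iff₀ (by positivity)]
  nlinarith

/-- Change of variables to sum and difference coordinates. -/
theorem integral_add_mul_sub (P Q : ℝ → ℂ) :
    ∫ ξ : ℝ × ℝ, P (ξ.1 + ξ.2) * Q (ξ.1 - ξ.2) = 2⁻¹ * ((∫ x, P x) * ∫ x, Q x) := by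
  set T : (ℝ × ℝ) →ₗ[ℝ] ℝ × ℝ := (LinearMap.fst ℝ ℝ ℝ + LinearMap.snd ℝ ℝ ℝ).prod
    (LinearMap.fst ℝ ℝ ℝ - LinearMap.snd ℝ ℝ ℝ) with hT
  have hdet : LinearMap.det T = -2 := by
    rw [← LinearMap.det_toMatrix (Module.Basis.finTwoProd ℝ), Matrix.det_fin_two]
    simp [LinearMap.toMatrix_apply, hT]
    norm_num
  have hmap := Measure.map_linearMap_addHaar_eq_smul_addHaar (volume : Measure (ℝ × ℝ)) (f := T)
    (by rw [hdet]; norm_num)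
  have hemb : MeasurableEmbedding T := by
    have hinj : Function.Injective T := by
      intro x y h
      have h₁ : x.1 + x.2 = y.1 + y.2 := congrArg Prod.fst h
      have h₂ : x.1 - x.2 = y.1 - y.2 := congrArg Prod.snd h
      ext <;> linarith
    exact T.continuous_of_finiteDimensional.measurableEmbedding hinj
  have h := hemb.integral_map (μ := volume) (fun x : ℝ × ℝ => P x.1 * Q x.2)
  rw [hmap, integral_smul_measure, hdet] at h
  rw [Measure.volume_eq_prod, integral_prod_mul, ← Measure.volume_eq_prod] at h
  refine Eq.trans ?_ (h.symm.trans ?_)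
  · rfl
  · norm_num [Complex.real_smul]

theorem norm_integral_halfGauss_mul_freqGauss (Ω ν τ : ℝ) :
    ‖∫ η : ℝ, ((halfGauss (η - Ω) * freqGauss (η - ν) : ℝ) : ℂ) * e2pi (η * τ)‖ =
      ‖((Real.pi : ℂ) / (3 * Real.pi ^ 2 / 2)) ^ (1 / 2 : ℂ)‖ *
        (Real.exp (-(Real.pi ^ 2 / 3) * (ν - Ω) ^ 2) * Real.exp (-(2 / 3) * τ ^ 2)) := by
  have h := integral_cexp_quadratic (b := ((-(3 * Real.pi ^ 2 / 2) : ℝ) : ℂ))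
    (by rw [Complex.ofReal_re]; exact neg_lt_zero.mpr (by positivity))
    (((Real.pi ^ 2 * (Ω + 2 * ν) : ℝ) : ℂ) + ((2 * Real.pi * τ : ℝ) : ℂ) * I)
    ((-(Real.pi ^ 2 / 2 * Ω ^ 2) - Real.pi ^ 2 * ν ^ 2 : ℝ) : ℂ)
  have hpi : (Real.pi : ℂ) ≠ 0 := by exact_mod_cast Real.pi_ne_zero
  have hL : ∀ η : ℝ, ((halfGauss (η - Ω) * freqGauss (η - ν) : ℝ) : ℂ) * e2pi (η * τ) =
      Complex.exp (((-(3 * Real.pi ^ 2 / 2) : ℝ) : ℂ) * (η : ℂ) ^ 2 +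
        (((Real.pi ^ 2 * (Ω + 2 * ν) : ℝ) : ℂ) + ((2 * Real.pi * τ : ℝ) : ℂ) * I) * η +
        ((-(Real.pi ^ 2 / 2 * Ω ^ 2) - Real.pi ^ 2 * ν ^ 2 : ℝ) : ℂ)) := by
    intro η
    rw [halfGauss, freqGauss, e2pi, ← Real.exp_add, Complex.ofReal_exp, ← Complex.exp_add]
    congr 1
    push_cast
    ring
  simp_rw [hL]
  rw [h, norm_mul, Complex.norm_exp, ← Real.exp_add]
  congr 2
  · congr 1
    push_cast
    ring
  · have : ((-(Real.pi ^ 2 / 2 * Ω ^ 2) - Real.pi ^ 2 * ν ^ 2 : ℝ) : ℂ) -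
        (((Real.pi ^ 2 * (Ω + 2 * ν) : ℝ) : ℂ) + ((2 * Real.pi * τ : ℝ) : ℂ) * I) ^ 2 /
          (4 * ((-(3 * Real.pi ^ 2 / 2) : ℝ) : ℂ)) =
        ((-(Real.pi ^ 2 / 3) * (ν - Ω) ^ 2 + -(2 / 3) * τ ^ 2 : ℝ) : ℂ) +
          ((2 * Real.pi * (Ω + 2 * ν) * τ / 3 : ℝ) : ℂ) * I := by
      push_cast
      field_simp
      linear_combination (16 * (τ : ℂ) ^ 2) * Complex.I_sq
    rw [this, Complex.add_re, Complex.ofReal_re, Complex.re_ofReal_mul, Complex.I_re, mul_zero,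
      add_zero]

theorem STFT1_fourier_integral {u : ℝ × ℝ → ℂ} (hu : Integrable u) (t ν : ℝ) :
    STFT1 gauss1 (fun y => ∫ ξ, u ξ * e2pi (y * (ξ.1 + ξ.2))) t ν =
      (√Real.pi : ℂ) *
        ∫ ξ, u ξ * (freqGauss (ξ.1 + ξ.2 - ν) * e2pi (t * (ξ.1 + ξ.2 - ν))) := by
  have hint : Integrable (Function.uncurry fun (y : ℝ) (ξ : ℝ × ℝ) =>
      gauss1 (y - t) * u ξ * e2pi (y * (ξ.1 + ξ.2 - ν))) (volume.prod volume) :=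
    ((integrable_gauss1.comp_sub_right t).mul_prod hu).mul_bdd (c := 1) (by fun_prop)
      (Filter.Eventually.of_forall fun _ => (norm_e2pi _).le)
  calc STFT1 gauss1 (fun y => ∫ ξ, u ξ * e2pi (y * (ξ.1 + ξ.2))) t ν
      = ∫ y, ∫ ξ, gauss1 (y - t) * u ξ * e2pi (y * (ξ.1 + ξ.2 - ν)) := by
        unfold STFT1
        congr 1 with y
        rw [← integral_mul_const, ← integral_mul_const]
        congr 1 with ξ
        rw [show y * (ξ.1 + ξ.2 - ν) = y * (ξ.1 + ξ.2) + -(y * ν) by ring, e2pi_add]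
        ring
    _ = ∫ ξ, ∫ y, gauss1 (y - t) * u ξ * e2pi (y * (ξ.1 + ξ.2 - ν)) :=
        integral_integral_swap hint
    _ = _ := by
        rw [← integral_const_mul]
        congr 1 with ξ
        rw [← integral_add_right_eq_self _ t]
        simp_rw [add_sub_cancel_right, add_mul, e2pi_add]
        have h := integral_gauss1_mul_e2pi (ξ.1 + ξ.2 - ν)
        calc ∫ y, gauss1 y * u ξ * (e2pi (y * (ξ.1 + ξ.2 - ν)) * e2pi (t * (ξ.1 + ξ.2 - ν)))
            = ∫ y, u ξ * e2pi (t * (ξ.1 + ξ.2 - ν)) *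
                (gauss1 y * e2pi (y * (ξ.1 + ξ.2 - ν))) := by
              congr 1 with y
              ring
          _ = _ := by
              rw [integral_const_mul, h]
              ring

/-- Insertion of a Gaussian partition of unity. -/
theorem exists_enorm_integral_le_lintegral_freqGauss :
    ∃ K : ℝ≥0∞, K ≠ ∞ ∧ ∀ u : ℝ × ℝ → ℂ, Integrable u →
      ‖∫ ξ, u ξ‖ₑ ≤ K * ∫⁻ ω : ℝ × ℝ, ‖∫ ξ, u ξ *
        ((freqGauss (ξ.1 - ω.1) ^ 2 * freqGauss (ξ.2 - ω.2) ^ 2 : ℝ) : ℂ)‖ₑ := by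
  have hsq : ∀ x, freqGauss x ^ 2 = Real.exp (-(2 * Real.pi ^ 2) * x ^ 2) := by
    intro x
    rw [freqGauss, ← Real.exp_nat_mul]
    congr 1
    push_cast
    ring
  have hgi : Integrable fun x => ((freqGauss x ^ 2 : ℝ) : ℂ) := by
    simp_rw [hsq]
    exact (integrable_exp_neg_mul_sq (by positivity)).ofReal
  set ρ : ℝ × ℝ → ℂ := fun z => ((freqGauss z.1 ^ 2 : ℝ) : ℂ) * ((freqGauss z.2 ^ 2 : ℝ) : ℂ)
    with hρ
  have hρi : Integrable ρ := hgi.mul_prod hgi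
  have hR : ∫ z, ρ z ≠ 0 := by
    have h := integral_prod_mul (μ := volume) (ν := volume)
      (fun x => ((freqGauss x ^ 2 : ℝ) : ℂ)) (fun x => ((freqGauss x ^ 2 : ℝ) : ℂ))
    rw [← Measure.volume_eq_prod] at h
    rw [hρ, h, mul_self_ne_zero, integral_complex_ofReal,
      Complex.ofReal_ne_zero]
    simp_rw [hsq]
    rw [integral_gaussian]
    positivity
  refine ⟨‖∫ z, ρ z‖ₑ⁻¹, ENNReal.inv_ne_top.mpr (enorm_ne_zero.mpr hR), fun u hu => ?_⟩
  have hconv := integral_convolution (ContinuousLinearMap.mul ℂ ℂ) hu hρi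
  rw [ContinuousLinearMap.mul_apply'] at hconv
  have hle : ‖∫ z, ρ z‖ₑ * ‖∫ ξ, u ξ‖ₑ ≤ ∫⁻ ω : ℝ × ℝ, ‖∫ ξ, u ξ *
      ((freqGauss (ξ.1 - ω.1) ^ 2 * freqGauss (ξ.2 - ω.2) ^ 2 : ℝ) : ℂ)‖ₑ := by
    rw [← enorm_mul, mul_comm, ← hconv]
    refine (enorm_integral_le_lintegral_enorm _).trans_eq ?_
    congr 1 with ω
    rw [convolution_def]
    congr 2 with ξ
    rw [ContinuousLinearMap.mul_apply', hρ, ← freqGauss_neg (ξ.1 - ω.1),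
      ← freqGauss_neg (ξ.2 - ω.2)]
    simp
  rw [← ENNReal.div_eq_inv_mul,
    ENNReal.le_div_iff_mul_le (Or.inl (enorm_ne_zero.mpr hR)) (Or.inl enorm_ne_top), mul_comm]
  exact hle

theorem integral_mul_fourier_swap {a Ψ : ℝ × ℝ → ℂ} (ha : Integrable a) (hΨ : Integrable Ψ) :
    ∫ ξ, Ψ ξ * ∫ s, a s * e2pi (-(s.1 * ξ.1 + s.2 * ξ.2)) =
      ∫ s, a s * ∫ ξ, Ψ ξ * e2pi (-(s.1 * ξ.1 + s.2 * ξ.2)) := by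
  have hint : Integrable (Function.uncurry fun (ξ s : ℝ × ℝ) =>
      Ψ ξ * a s * e2pi (-(s.1 * ξ.1 + s.2 * ξ.2))) (volume.prod volume) :=
    (hΨ.mul_prod ha).mul_bdd (c := 1) (by fun_prop)
      (Filter.Eventually.of_forall fun _ => (norm_e2pi _).le)
  simp_rw [← integral_const_mul]
  calc ∫ ξ, ∫ s, Ψ ξ * (a s * e2pi (-(s.1 * ξ.1 + s.2 * ξ.2)))
      = ∫ ξ, ∫ s, Ψ ξ * a s * e2pi (-(s.1 * ξ.1 + s.2 * ξ.2)) := by simp_rw [mul_assoc]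
    _ = ∫ s, ∫ ξ, Ψ ξ * a s * e2pi (-(s.1 * ξ.1 + s.2 * ξ.2)) := integral_integral_swap hint
    _ = _ := by
        congr 1 with s
        congr 1 with ξ
        ring

/-- The symbol of the bilinear Hilbert transform. -/
def bhSymbol (ξ : ℝ × ℝ) : ℂ := -(Real.pi : ℂ) * Complex.I * (Real.sign (ξ.1 - ξ.2) : ℝ)

theorem measurable_bhSymbol : Measurable bhSymbol := by
  have h : Measurable fun ξ : ℝ × ℝ => Real.sign (ξ.1 - ξ.2) :=
    measurable_sign.comp (by fun_prop)
  exact (Complex.measurable_ofReal.comp h).const_mul _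

theorem norm_bhSymbol_le (ξ : ℝ × ℝ) : ‖bhSymbol ξ‖ ≤ Real.pi := by
  have h := abs_sign_le_one (ξ.1 - ξ.2)
  simp only [bhSymbol, norm_mul, norm_neg, Complex.norm_I, Complex.norm_real, mul_one,
    Real.norm_eq_abs, abs_of_pos Real.pi_pos]
  exact mul_le_of_le_one_right Real.pi_pos.le h

/-- The phase-space localized symbol of the bilinear Hilbert transform. -/
def localSymbol (t ν : ℝ) (ω ξ : ℝ × ℝ) : ℂ :=
  bhSymbol ξ * (freqGauss (ξ.1 + ξ.2 - ν) * e2pi (t * (ξ.1 + ξ.2 - ν))) *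
    (freqGauss (ξ.1 - ω.1) * freqGauss (ξ.2 - ω.2))

theorem norm_bhSymbol_mul_le (t ν : ℝ) (ξ : ℝ × ℝ) :
    ‖bhSymbol ξ * (freqGauss (ξ.1 + ξ.2 - ν) * e2pi (t * (ξ.1 + ξ.2 - ν)))‖ ≤ Real.pi := by
  rw [norm_mul, norm_mul, norm_e2pi, mul_one, Complex.norm_real,
    Real.norm_of_nonneg (freqGauss_pos _).le]
  exact (mul_le_of_le_one_right (norm_nonneg _) (freqGauss_le_one _)).trans (norm_bhSymbol_le ξ)

theorem measurable_bhSymbol_mul (t ν : ℝ) : Measurable fun ξ : ℝ × ℝ =>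
    bhSymbol ξ * (freqGauss (ξ.1 + ξ.2 - ν) * e2pi (t * (ξ.1 + ξ.2 - ν))) := by
  refine measurable_bhSymbol.mul (Continuous.measurable ?_)
  fun_prop

theorem integrable_localSymbol (t ν : ℝ) (ω : ℝ × ℝ) : Integrable (localSymbol t ν ω) :=
  ((integrable_freqGauss.comp_sub_right ω.1).ofReal.mul_prod
    (integrable_freqGauss.comp_sub_right ω.2).ofReal).bdd_mul (c := Real.pi)
      (measurable_bhSymbol_mul t ν).aestronglyMeasurable
      (Filter.Eventually.of_forall fun ξ => norm_bhSymbol_mul_le t ν ξ)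

theorem localSymbol_mul_e2pi (t ν : ℝ) (ω s ξ : ℝ × ℝ) :
    localSymbol t ν ω ξ * e2pi (-(s.1 * ξ.1 + s.2 * ξ.2)) =
      -(Real.pi : ℂ) * I * e2pi (-(t * ν)) *
        ((((halfGauss (ξ.1 + ξ.2 - (ω.1 + ω.2)) * freqGauss (ξ.1 + ξ.2 - ν) : ℝ) : ℂ) *
            e2pi ((ξ.1 + ξ.2) * (t - (s.1 + s.2) / 2))) *
          (((Real.sign (ξ.1 - ξ.2) * halfGauss (ξ.1 - ξ.2 - (ω.1 - ω.2)) : ℝ) : ℂ) *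
            e2pi ((ξ.1 - ξ.2) * -((s.1 - s.2) / 2)))) := by
  have hg : (freqGauss (ξ.1 - ω.1) : ℂ) * freqGauss (ξ.2 - ω.2) =
      halfGauss (ξ.1 + ξ.2 - (ω.1 + ω.2)) * halfGauss (ξ.1 - ξ.2 - (ω.1 - ω.2)) := by
    have h := freqGauss_mul_freqGauss (ξ.1 - ω.1) (ξ.2 - ω.2)
    rw [show ξ.1 - ω.1 + (ξ.2 - ω.2) = ξ.1 + ξ.2 - (ω.1 + ω.2) by ring,
      show ξ.1 - ω.1 - (ξ.2 - ω.2) = ξ.1 - ξ.2 - (ω.1 - ω.2) by ring] at h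
    exact_mod_cast h
  have he : e2pi (t * (ξ.1 + ξ.2 - ν)) * e2pi (-(s.1 * ξ.1 + s.2 * ξ.2)) =
      e2pi (-(t * ν)) * e2pi ((ξ.1 + ξ.2) * (t - (s.1 + s.2) / 2)) *
        e2pi ((ξ.1 - ξ.2) * -((s.1 - s.2) / 2)) := by
    rw [← e2pi_add, ← e2pi_add, ← e2pi_add]
    congr 1
    ring
  rw [localSymbol, bhSymbol, hg]
  push_cast
  linear_combination (-(Real.pi : ℂ) * I * (Real.sign (ξ.1 - ξ.2) : ℝ) *
    freqGauss (ξ.1 + ξ.2 - ν) * halfGauss (ξ.1 + ξ.2 - (ω.1 + ω.2)) *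
    halfGauss (ξ.1 - ξ.2 - (ω.1 - ω.2))) * he

theorem exists_enorm_integral_localSymbol_le :
    ∃ K : ℝ≥0∞, K ≠ ∞ ∧ ∀ (t ν : ℝ) (ω s : ℝ × ℝ),
      ‖∫ ξ, localSymbol t ν ω ξ * e2pi (-(s.1 * ξ.1 + s.2 * ξ.2))‖ₑ ≤
        K * (expSq (Real.pi ^ 2 / 3) (ν - (ω.1 + ω.2)) *
          (expSq (2 / 3) (t - (s.1 + s.2) / 2) * decay ((s.1 - s.2) / 2))) := by
  obtain ⟨C, hC, hB⟩ := exists_norm_integral_sign_halfGauss_le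
  set D := ‖((Real.pi : ℂ) / (3 * Real.pi ^ 2 / 2)) ^ (1 / 2 : ℂ)‖ with hD
  have hD₀ : 0 ≤ D := norm_nonneg _
  refine ⟨ENNReal.ofReal (Real.pi * 2⁻¹ * D * C), ENNReal.ofReal_ne_top, fun t ν ω s => ?_⟩
  have hpi := Real.pi_pos
  simp_rw [localSymbol_mul_e2pi]
  rw [integral_const_mul, integral_add_mul_sub
    (fun η => ((halfGauss (η - (ω.1 + ω.2)) * freqGauss (η - ν) : ℝ) : ℂ) *
      e2pi (η * (t - (s.1 + s.2) / 2)))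
    (fun ζ => ((Real.sign ζ * halfGauss (ζ - (ω.1 - ω.2)) : ℝ) : ℂ) *
      e2pi (ζ * -((s.1 - s.2) / 2)))]
  simp only [expSq, decay]
  rw [← ENNReal.ofReal_mul (by positivity), ← ENNReal.ofReal_mul (by positivity),
    ← ENNReal.ofReal_mul (by positivity), ← ofReal_norm]
  refine ENNReal.ofReal_le_ofReal ?_
  rw [norm_mul, norm_mul (2⁻¹ : ℂ), norm_mul (∫ _, _), norm_integral_halfGauss_mul_freqGauss, ← hD]
  have hB' := hB (ω.1 - ω.2) (-((s.1 - s.2) / 2))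
  rw [abs_neg] at hB'
  have hc : ‖-(Real.pi : ℂ) * I * e2pi (-(t * ν))‖ = Real.pi := by
    simp [norm_e2pi, abs_of_pos hpi]
  have h2 : ‖(2⁻¹ : ℂ)‖ = 2⁻¹ := by simp
  rw [hc, h2]
  calc _ ≤ Real.pi * (2⁻¹ * (D * (Real.exp (-(Real.pi ^ 2 / 3) * (ν - (ω.1 + ω.2)) ^ 2) *
        Real.exp (-(2 / 3) * (t - (s.1 + s.2) / 2) ^ 2)) *
          (C * (1 + |(s.1 - s.2) / 2|)⁻¹))) := by gcongr
    _ = _ := by ring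

/-- Up to unimodular factors, the tensor product of the short-time Fourier transforms of `f` and
`g` at the frequencies `ω`. -/
def stftTensor (f g : ℝ → ℂ) (ω s : ℝ × ℝ) : ℂ :=
  (STFT1 gauss1 f s.1 ω.1 * e2pi (s.1 * ω.1)) * (STFT1 gauss1 g s.2 ω.2 * e2pi (s.2 * ω.2))

theorem integrable_stftTensor {f g : ℝ → ℂ} (hf : Integrable f) (hg : Integrable g)
    (ω : ℝ × ℝ) : Integrable (stftTensor f g ω) := by
  have h₁ : Integrable fun s => STFT1 gauss1 f s ω.1 * e2pi (s * ω.1) :=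
    integrable_mul_e2pi (integrable_STFT1 hf ω.1) (φ := fun s => s * ω.1) (by fun_prop)
  have h₂ : Integrable fun s => STFT1 gauss1 g s ω.2 * e2pi (s * ω.2) :=
    integrable_mul_e2pi (integrable_STFT1 hg ω.2) (φ := fun s => s * ω.2) (by fun_prop)
  exact h₁.mul_prod h₂

theorem enorm_stftTensor (f g : ℝ → ℂ) (ω s : ℝ × ℝ) :
    ‖stftTensor f g ω s‖ₑ = ‖STFT1 gauss1 f s.1 ω.1‖ₑ * ‖STFT1 gauss1 g s.2 ω.2‖ₑ := by
  have he : ∀ x, ‖e2pi x‖ₑ = 1 := fun x => by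
    rw [← ofReal_norm, norm_e2pi, ENNReal.ofReal_one]
  simp only [stftTensor, enorm_mul, he, mul_one]

theorem integral_stftTensor_mul_e2pi {f g : ℝ → ℂ} (hf : Integrable f) (hg : Integrable g)
    (ω ξ : ℝ × ℝ) :
    ∫ s, stftTensor f g ω s * e2pi (-(s.1 * ξ.1 + s.2 * ξ.2)) =
      Real.pi * ((FT1 f ξ.1 * freqGauss (ξ.1 - ω.1)) * (FT1 g ξ.2 * freqGauss (ξ.2 - ω.2))) := by
  have hpi : (√Real.pi : ℂ) * (√Real.pi : ℂ) = Real.pi := by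
    exact_mod_cast Real.mul_self_sqrt Real.pi_pos.le
  have hs : ∀ s : ℝ × ℝ, stftTensor f g ω s * e2pi (-(s.1 * ξ.1 + s.2 * ξ.2)) =
      (STFT1 gauss1 f s.1 ω.1 * e2pi (s.1 * (ω.1 - ξ.1))) *
        (STFT1 gauss1 g s.2 ω.2 * e2pi (s.2 * (ω.2 - ξ.2))) := by
    intro s
    have he : e2pi (s.1 * ω.1) * e2pi (s.2 * ω.2) * e2pi (-(s.1 * ξ.1 + s.2 * ξ.2)) =
        e2pi (s.1 * (ω.1 - ξ.1)) * e2pi (s.2 * (ω.2 - ξ.2)) := by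
      rw [← e2pi_add, ← e2pi_add, ← e2pi_add]
      congr 1
      ring
    rw [stftTensor]
    linear_combination (STFT1 gauss1 f s.1 ω.1 * STFT1 gauss1 g s.2 ω.2) * he
  simp_rw [hs]
  refine (integral_prod_mul (fun s => STFT1 gauss1 f s ω.1 * e2pi (s * (ω.1 - ξ.1)))
    (fun s => STFT1 gauss1 g s ω.2 * e2pi (s * (ω.2 - ξ.2)))).trans ?_
  rw [integral_STFT1_mul_e2pi hf, integral_STFT1_mul_e2pi hg, ← hpi]
  ring

/-- The frequency-localized piece of the bilinear Hilbert transform as a phase-space integral. -/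
theorem integral_localized_eq {f g : ℝ → ℂ} (hf : Integrable f) (hg : Integrable g)
    (t ν : ℝ) (ω : ℝ × ℝ) :
    ∫ ξ : ℝ × ℝ, bhSymbol ξ * FT1 f ξ.1 * FT1 g ξ.2 *
        (freqGauss (ξ.1 + ξ.2 - ν) * e2pi (t * (ξ.1 + ξ.2 - ν))) *
        ((freqGauss (ξ.1 - ω.1) ^ 2 * freqGauss (ξ.2 - ω.2) ^ 2 : ℝ) : ℂ) =
      (Real.pi : ℂ)⁻¹ * ∫ s, stftTensor f g ω s *
        ∫ ξ, localSymbol t ν ω ξ * e2pi (-(s.1 * ξ.1 + s.2 * ξ.2)) := by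
  have hpi : (Real.pi : ℂ) ≠ 0 := by exact_mod_cast Real.pi_ne_zero
  rw [← integral_mul_fourier_swap (integrable_stftTensor hf hg ω) (integrable_localSymbol t ν ω),
    ← integral_const_mul]
  congr 1 with ξ
  rw [integral_stftTensor_mul_e2pi hf hg, localSymbol]
  push_cast
  field_simp

theorem exists_enorm_STFT1_BH_le :
    ∃ K : ℝ≥0∞, K ≠ ∞ ∧ ∀ (f g : SchwartzMap ℝ ℂ) (t ν : ℝ),
      ‖STFT1 gauss1 (BH f g) t ν‖ₑ ≤ K * ∫⁻ ω : ℝ × ℝ,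
        expSq (Real.pi ^ 2 / 3) (ν - (ω.1 + ω.2)) *
          timeForm (2 / 3) (fun s => ‖STFT1 gauss1 f s ω.1‖ₑ)
            (fun s => ‖STFT1 gauss1 g s ω.2‖ₑ) t := by
  obtain ⟨K₁, hK₁, h₁⟩ := exists_enorm_integral_le_lintegral_freqGauss
  obtain ⟨K₂, hK₂, h₂⟩ := exists_enorm_integral_localSymbol_le
  have hcc : ‖(Real.pi : ℂ)⁻¹‖ₑ * K₂ ≠ ∞ := ENNReal.mul_ne_top enorm_ne_top hK₂
  refine ⟨‖(√Real.pi : ℂ)‖ₑ * K₁ * (‖(Real.pi : ℂ)⁻¹‖ₑ * K₂),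
    ENNReal.mul_ne_top (ENNReal.mul_ne_top enorm_ne_top hK₁) hcc, fun f g t ν => ?_⟩
  have hf : Integrable f := f.integrable
  have hg : Integrable g := g.integrable
  have hu₀ : Integrable fun ξ : ℝ × ℝ => FT1 f ξ.1 * FT1 g ξ.2 :=
    (integrable_FT1 f).mul_prod (integrable_FT1 g)
  have hu : Integrable fun ξ : ℝ × ℝ => bhSymbol ξ * FT1 f ξ.1 * FT1 g ξ.2 := by
    simp_rw [mul_assoc]
    exact hu₀.bdd_mul (c := Real.pi) measurable_bhSymbol.aestronglyMeasurable
      (Filter.Eventually.of_forall norm_bhSymbol_le)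
  have hw : Integrable fun ξ : ℝ × ℝ => bhSymbol ξ * FT1 f ξ.1 * FT1 g ξ.2 *
      (freqGauss (ξ.1 + ξ.2 - ν) * e2pi (t * (ξ.1 + ξ.2 - ν))) := by
    refine (hu₀.bdd_mul (c := Real.pi) (measurable_bhSymbol_mul t ν).aestronglyMeasurable
      (Filter.Eventually.of_forall fun ξ => norm_bhSymbol_mul_le t ν ξ)).congr
        (Filter.Eventually.of_forall fun ξ => ?_)
    dsimp only
    ring
  have hV : STFT1 gauss1 (BH f g) t ν = (√Real.pi : ℂ) * ∫ ξ : ℝ × ℝ,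
      bhSymbol ξ * FT1 f ξ.1 * FT1 g ξ.2 *
        (freqGauss (ξ.1 + ξ.2 - ν) * e2pi (t * (ξ.1 + ξ.2 - ν))) :=
    STFT1_fourier_integral hu t ν
  have hJ : ∀ ω : ℝ × ℝ,
      ‖∫ ξ : ℝ × ℝ, bhSymbol ξ * FT1 f ξ.1 * FT1 g ξ.2 *
        (freqGauss (ξ.1 + ξ.2 - ν) * e2pi (t * (ξ.1 + ξ.2 - ν))) *
        ((freqGauss (ξ.1 - ω.1) ^ 2 * freqGauss (ξ.2 - ω.2) ^ 2 : ℝ) : ℂ)‖ₑ ≤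
      ‖(Real.pi : ℂ)⁻¹‖ₑ * K₂ * (expSq (Real.pi ^ 2 / 3) (ν - (ω.1 + ω.2)) *
          timeForm (2 / 3) (fun s => ‖STFT1 gauss1 f s ω.1‖ₑ)
            (fun s => ‖STFT1 gauss1 g s ω.2‖ₑ) t) := by
    intro ω
    have hE : K₂ * expSq (Real.pi ^ 2 / 3) (ν - (ω.1 + ω.2)) ≠ ∞ :=
      ENNReal.mul_ne_top hK₂ ENNReal.ofReal_ne_top
    rw [integral_localized_eq hf hg, enorm_mul, mul_assoc]
    gcongr
    refine (enorm_integral_le_lintegral_enorm _).trans ?_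
    calc ∫⁻ s, ‖stftTensor f g ω s *
          ∫ ξ, localSymbol t ν ω ξ * e2pi (-(s.1 * ξ.1 + s.2 * ξ.2))‖ₑ
        ≤ ∫⁻ s : ℝ × ℝ, K₂ * expSq (Real.pi ^ 2 / 3) (ν - (ω.1 + ω.2)) *
            (‖STFT1 gauss1 f s.1 ω.1‖ₑ * ‖STFT1 gauss1 g s.2 ω.2‖ₑ *
              (expSq (2 / 3) (t - (s.1 + s.2) / 2) * decay ((s.1 - s.2) / 2))) := by
          refine lintegral_mono fun s => ?_
          rw [enorm_mul, enorm_stftTensor]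
          refine (mul_le_mul_right (h₂ t ν ω s) _).trans_eq ?_
          ring
      _ = _ := by
          rw [lintegral_const_mul' _ _ hE, mul_assoc]
          rfl
  rw [hV, enorm_mul]
  calc _ ≤ ‖(√Real.pi : ℂ)‖ₑ * (K₁ * ∫⁻ ω : ℝ × ℝ, ‖(Real.pi : ℂ)⁻¹‖ₑ * K₂ *
        (expSq (Real.pi ^ 2 / 3) (ν - (ω.1 + ω.2)) *
          timeForm (2 / 3) (fun s => ‖STFT1 gauss1 f s ω.1‖ₑ)
            (fun s => ‖STFT1 gauss1 g s ω.2‖ₑ) t)) := by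
        gcongr
        exact (h₁ _ hw).trans (mul_le_mul_right (lintegral_mono hJ) _)
    _ = _ := by
        rw [lintegral_const_mul' _ _ hcc]
        ring

theorem essSup_eq_iSup_of_continuous {F : ℝ → ℝ≥0∞} (hF : Continuous F) :
    essSup F volume = ⨆ t, F t := by
  refine le_antisymm (essSup_le_of_ae_le _ (Filter.Eventually.of_forall fun t => le_iSup F t))
    (iSup_le fun t => ?_)
  have hd : Dense {t | F t ≤ essSup F volume} := Measure.dense_of_ae (ENNReal.ae_le_essSup F)
  have hc : IsClosed {t | F t ≤ essSup F volume} := isClosed_le hF continuous_const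
  have h := hd t
  rwa [hc.closure_eq] at h

theorem measurable_recipNorm_of_continuous {a : ℝ} (ha : 0 ≤ a) {H : ℝ → ℝ → ℝ≥0∞}
    (hH : Continuous (Function.uncurry H)) : Measurable fun ω => recipNorm a fun t => H t ω := by
  rcases ha.eq_or_lt with rfl | ha
  · have h : ∀ ω, (recipNorm 0 fun t => H t ω) = ⨆ t, H t ω := fun ω => by
      rw [recipNorm_zero, essSup_eq_iSup_of_continuous (by fun_prop)]
    simp_rw [h]
    refine (lowerSemicontinuous_iSup fun t => ?_).measurable
    exact (by fun_prop : Continuous fun ω => H t ω).lowerSemicontinuous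
  · simp_rw [recipNorm_of_pos ha]
    refine Measurable.pow_const ?_ _
    exact (hH.measurable.pow_const (1 / a)).lintegral_prod_left'

theorem measurable_timeForm {k : ℝ} {α : Type*} [MeasurableSpace α] {F G : ℝ × α → ℝ≥0∞}
    (hF : Measurable F) (hG : Measurable G) :
    Measurable fun z : ℝ × α × α =>
      timeForm k (fun s => F (s, z.2.1)) (fun s => G (s, z.2.2)) z.1 := by
  unfold timeForm
  have h : Measurable fun p : (ℝ × α × α) × (ℝ × ℝ) =>
      F (p.2.1, p.1.2.1) * G (p.2.2, p.1.2.2) *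
        (expSq k (p.1.1 - (p.2.1 + p.2.2) / 2) * decay ((p.2.1 - p.2.2) / 2)) :=
    ((hF.comp (by fun_prop)).mul (hG.comp (by fun_prop))).mul
      (((measurable_expSq k).comp (by fun_prop)).mul (measurable_decay.comp (by fun_prop)))
  exact h.lintegral_prod_right'

theorem exists_recipNorm_mixed_le {k l a b c a' b' c' : ℝ} (hk : 0 < k) (hl : 0 < l)
    (ha₀ : 0 ≤ a) (ha : a ≤ 1) (hb₀ : 0 ≤ b) (hb : b ≤ 1) (hc₀ : 0 ≤ c) (hc : c ≤ 1)
    (habc : c < a + b) (ha₀' : 0 ≤ a') (ha' : a' ≤ 1) (hb' : b' ≤ 1) (hc₀' : 0 ≤ c')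
    (habc' : 1 + c' ≤ a' + b') :
    ∃ K : ℝ≥0∞, K ≠ ∞ ∧ ∀ (K₀ : ℝ≥0∞) (F G H : ℝ → ℝ → ℝ≥0∞), K₀ ≠ ∞ →
      Continuous (Function.uncurry F) → Continuous (Function.uncurry G) →
      (∀ t ν, H t ν ≤ K₀ * ∫⁻ ω : ℝ × ℝ, expSq l (ν - (ω.1 + ω.2)) *
        timeForm k (fun s => F s ω.1) (fun s => G s ω.2) t) →
      recipNorm c' (fun ν => recipNorm c fun t => H t ν) ≤
        K * K₀ * (recipNorm a' (fun ω => recipNorm a fun t => F t ω) *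
          recipNorm b' (fun ω => recipNorm b fun t => G t ω)) := by
  obtain ⟨K₁, hK₁, h₁⟩ := exists_recipNorm_timeForm_le hk ha₀ ha hb₀ hb hc₀ hc habc
  obtain ⟨K₂, hK₂, h₂⟩ := exists_recipNorm_freqForm_le hl ha' hb' hc₀' habc'
  refine ⟨K₂ * K₁, ENNReal.mul_ne_top hK₂ hK₁, fun K₀ F G H hK₀ hF hG hH => ?_⟩
  set X : ℝ → ℝ≥0∞ := fun ω => recipNorm a fun t => F t ω with hX
  set Y : ℝ → ℝ≥0∞ := fun ω => recipNorm b fun t => G t ω with hY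
  have hXm : Measurable X := measurable_recipNorm_of_continuous ha₀ hF
  have hYm : Measurable Y := measurable_recipNorm_of_continuous hb₀ hG
  set T : ℝ → ℝ × ℝ → ℝ≥0∞ := fun t ω =>
    timeForm k (fun s => F s ω.1) (fun s => G s ω.2) t with hT
  have hTm : Measurable (Function.uncurry T) := measurable_timeForm hF.measurable hG.measurable
  have hslice : ∀ ν, recipNorm c (fun t => H t ν) ≤
      ∫⁻ ω : ℝ × ℝ, expSq l (ν - (ω.1 + ω.2)) * (K₀ * K₁ * X ω.1 * Y ω.2) := by
    intro ν
    have hE : Measurable fun ω : ℝ × ℝ => expSq l (ν - (ω.1 + ω.2)) :=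
      (measurable_expSq _).comp (by fun_prop)
    calc recipNorm c (fun t => H t ν)
        ≤ recipNorm c (fun t => ∫⁻ ω : ℝ × ℝ,
            K₀ * expSq l (ν - (ω.1 + ω.2)) * T t ω) := by
          refine recipNorm_mono hc₀ fun t => (hH t ν).trans_eq ?_
          rw [← lintegral_const_mul' _ _ hK₀]
          simp_rw [hT, mul_assoc]
      _ ≤ _ := by
          refine recipNorm_lintegral_le hc₀ hc ?_ ?_ fun ω => ?_
          · exact ((hE.comp measurable_snd).const_mul K₀).mul hTm
          · exact hE.mul (((hXm.comp measurable_fst).const_mul _).mul (hYm.comp measurable_snd))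
          · have hTω : Measurable fun t => T t ω := hTm.comp measurable_prodMk_right
            rw [recipNorm_const_mul hc₀ _ hTω]
            refine (mul_le_mul_right (h₁ _ _ (hF.measurable.comp measurable_prodMk_right)
              (hG.measurable.comp measurable_prodMk_right)) _).trans_eq ?_
            simp only [hX, hY, Function.comp_def, Function.uncurry]
            ring
  refine (recipNorm_mono hc₀' hslice).trans ((h₂ _ Y (hXm.const_mul (K₀ * K₁)) hYm).trans_eq ?_)
  rw [recipNorm_const_mul ha₀' _ hXm]
  ring

theorem exists_recipNorm_STFT1_BH_le {a b c a' b' c' : ℝ} (ha₀ : 0 ≤ a) (ha : a ≤ 1)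
    (hb₀ : 0 ≤ b) (hb : b ≤ 1) (hc₀ : 0 ≤ c) (hc : c ≤ 1) (habc : c < a + b)
    (ha₀' : 0 ≤ a') (ha' : a' ≤ 1) (hb' : b' ≤ 1) (hc₀' : 0 ≤ c')
    (habc' : 1 + c' ≤ a' + b') :
    ∃ K : ℝ≥0∞, K ≠ ∞ ∧ ∀ f g : SchwartzMap ℝ ℂ,
      recipNorm c' (fun ν => recipNorm c fun t => ‖STFT1 gauss1 (BH f g) t ν‖ₑ) ≤
        K * (recipNorm a' (fun ω => recipNorm a fun t => ‖STFT1 gauss1 f t ω‖ₑ) *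
          recipNorm b' (fun ω => recipNorm b fun t => ‖STFT1 gauss1 g t ω‖ₑ)) := by
  obtain ⟨K₀, hK₀, h₀⟩ := exists_enorm_STFT1_BH_le
  obtain ⟨K, hK, h⟩ := exists_recipNorm_mixed_le (k := 2 / 3) (l := Real.pi ^ 2 / 3)
    (by norm_num) (by positivity) ha₀ ha hb₀ hb hc₀ hc habc ha₀' ha' hb' hc₀' habc'
  refine ⟨K * K₀, ENNReal.mul_ne_top hK hK₀, fun f g => ?_⟩
  exact h K₀ (fun t ω => ‖STFT1 gauss1 f t ω‖ₑ) (fun t ω => ‖STFT1 gauss1 g t ω‖ₑ)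
    (fun t ω => ‖STFT1 gauss1 (BH f g) t ω‖ₑ) hK₀ (continuous_STFT1 f.integrable).enorm
    (continuous_STFT1 g.integrable).enorm (h₀ f g)

/-- boundedness of the bilinear Hilbert transform on products of
modulation spaces. -/
theorem stmt15 (p₀ p₁ p₂ q₁ q₂ q₃ : ℝ≥0∞)
    (hp₀ : 1 ≤ p₀) (hp₁ : 1 ≤ p₁) (hp₂ : 1 ≤ p₂)
    (hq₁ : 1 ≤ q₁) (hq₂ : 1 ≤ q₂) (hq₃ : 1 ≤ q₃)
    (hP : 1 / p₀ < 1 / p₁ + 1 / p₂)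
    (hQ : 1 + 1 / q₃ ≤ 1 / q₁ + 1 / q₂) :
    ∃ C : ℝ≥0, 0 < C ∧
      ∀ f g : SchwartzMap ℝ ℂ,
        modNorm1 p₀ q₃ (BH (⇑f) (⇑g)) ≤
          (C : ℝ≥0∞) * modNorm1 p₁ q₁ (⇑f) * modNorm1 p₂ q₂ (⇑g) := by
  have hinv : ∀ {p : ℝ≥0∞}, 1 ≤ p → 0 ≤ (1 / p).toReal ∧ (1 / p).toReal ≤ 1 := by
    intro p hp
    refine ⟨ENNReal.toReal_nonneg, ENNReal.toReal_le_of_le_ofReal zero_le_one ?_⟩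
    simpa using hp
  have hfin : ∀ {p : ℝ≥0∞}, 1 ≤ p → 1 / p ≠ ∞ := fun hp =>
    ne_top_of_le_ne_top ENNReal.one_ne_top (by simpa using hp)
  have hP' : (1 / p₀).toReal < (1 / p₁).toReal + (1 / p₂).toReal := by
    rw [← ENNReal.toReal_add (hfin hp₁) (hfin hp₂)]
    exact ENNReal.toReal_strict_mono (ENNReal.add_ne_top.mpr ⟨hfin hp₁, hfin hp₂⟩) hP
  have hQ' : 1 + (1 / q₃).toReal ≤ (1 / q₁).toReal + (1 / q₂).toReal := by
    rw [← ENNReal.toReal_add (hfin hq₁) (hfin hq₂), ← ENNReal.toReal_one,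
      ← ENNReal.toReal_add ENNReal.one_ne_top (hfin hq₃)]
    exact ENNReal.toReal_mono (ENNReal.add_ne_top.mpr ⟨hfin hq₁, hfin hq₂⟩) hQ
  obtain ⟨K, hK, h⟩ := exists_recipNorm_STFT1_BH_le (hinv hp₁).1 (hinv hp₁).2 (hinv hp₂).1
    (hinv hp₂).2 (hinv hp₀).1 (hinv hp₀).2 hP' (hinv hq₁).1 (hinv hq₁).2 (hinv hq₂).2
    (hinv hq₃).1 hQ'
  refine ⟨K.toNNReal + 1, by positivity, fun f g => ?_⟩
  have hmod : ∀ {p q : ℝ≥0∞}, 1 ≤ p → 1 ≤ q → ∀ φ : ℝ → ℂ, modNorm1 p q φ =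
      recipNorm (1 / q).toReal fun ν => recipNorm (1 / p).toReal fun t =>
        ‖STFT1 gauss1 φ t ν‖ₑ := by
    intro p q hp hq φ
    rw [modNorm1, eNorm_eq_recipNorm hq]
    simp_rw [eNorm_eq_recipNorm hp]
    rfl
  rw [hmod hp₀ hq₃, hmod hp₁ hq₁, hmod hp₂ hq₂, mul_assoc]
  refine (h f g).trans (mul_le_mul_left ?_ _)
  rw [ENNReal.coe_add, ENNReal.coe_toNNReal hK]
  exact le_self_add

end
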